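/- Let T > 0. Let h : ℝ × ℝ → ℝ be continuous, T-periodic in the first variable, and satisfy (h0) and (h1). Let a : ℝ → ℝ be a locally integrable T-periodic function satisfying (a#) and (a*). Let g : [0,+∞) → [0,+∞) be continuous, regularly oscillating at zero, satisfy (g*), the superlinearity-at-zero condition: for every K ∈ ℝ, lim_{s→0⁺} h(t, K g(s))/s = 0 uniformly in t ∈ ℝ, and the superlinearity-at-infinity condition: for every K ∈ ℝ \ {0}, lim_{s→+∞} sign(K) · h(t, K g(s))/s = +∞ uniformly in t ∈ ℝ. Then for every λ > 0, the system u' = h(t,v), v' = -λ a(t) g(u) has at least one T-periodic solution (u,v) with u(t) > 0 for all t ∈ ℝ. -/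

import Mathlib

open MeasureTheory Set Filter

noncomputable section

/-- `(u, v)` is a `T`-periodic solution of the planar system `u' = F t (v t)`,
`v' = G t (u t)`: both components are continuous, `T`-periodic, and are primitives
(in the sense of the integral form, equivalent to absolute continuity plus the
differential equations holding almost everywhere) of the right-hand sides. -/
def IsPeriodicSol (T : ℝ) (F G : ℝ → ℝ → ℝ) (u v : ℝ → ℝ) : Prop :=
  Continuous u ∧ Continuous v ∧
  Function.Periodic u T ∧ Function.Periodic v T ∧
  (∀ t₁ t₂ : ℝ, IntervalIntegrable (fun s => F s (v s)) volume t₁ t₂) ∧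
  (∀ t₁ t₂ : ℝ, IntervalIntegrable (fun s => G s (u s)) volume t₁ t₂) ∧
  (∀ t : ℝ, u t = u 0 + ∫ s in (0:ℝ)..t, F s (v s)) ∧
  (∀ t : ℝ, v t = v 0 + ∫ s in (0:ℝ)..t, G s (u s))

/-- Condition (a*): there are `N + 1 ≥ 1` pairwise disjoint closed intervals
`[σ n, τ n]` contained in a period, on which `a > 0` a.e., while `a ≤ 0` a.e.
on the rest of the period. -/
def SignChanging (T : ℝ) (a : ℝ → ℝ) (N : ℕ) (σ τ : Fin (N + 1) → ℝ) : Prop :=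
  (∀ n, σ n < τ n) ∧
  (∀ m n : Fin (N + 1), m < n → τ m < σ n) ∧
  (∀ n, τ n < σ 0 + T) ∧
  (∀ n, ∀ᵐ t ∂volume, t ∈ Set.Icc (σ n) (τ n) → 0 < a t) ∧
  (∀ᵐ t ∂volume, t ∈ Set.Ico (σ 0) (σ 0 + T) \ (⋃ n, Set.Icc (σ n) (τ n)) → a t ≤ 0)

/-- `g` is regularly oscillating at zero: `g (ω s) / g s → 1` as `s → 0⁺` and `ω → 1`. -/
def RegOscZero (g : ℝ → ℝ) : Prop :=
  Tendsto (fun p : ℝ × ℝ => g (p.1 * p.2) / g p.2)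
    ((nhds 1) ×ˢ (nhdsWithin 0 (Set.Ioi 0))) (nhds 1)

section Brouwer

variable {E : Type*} [NormedAddCommGroup E] [InnerProductSpace ℝ E] [FiniteDimensional ℝ E]

/-- A `C¹` function on a closed ball that vanishes on the boundary sphere is, after extension
by zero, globally Lipschitz. -/
lemma exists_lipschitzWith_indicator_ball {w : E → E} (hw : ContDiff ℝ 1 w) {L : ℝ}
    (hw0 : ∀ x, ‖x‖ = L → w x = 0) :
    ∃ C : NNReal, LipschitzWith C ((Metric.ball (0 : E) L).indicator w) := by
  obtain ⟨C, hC⟩ : ∃ C : NNReal, LipschitzOnWith C w (Metric.closedBall 0 L) := by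
    obtain ⟨C, hC⟩ := (isCompact_closedBall (0 : E) L).exists_bound_of_continuousOn
      (hw.continuous_fderiv one_ne_zero).continuousOn
    refine ⟨C.toNNReal, (convex_closedBall 0 L).lipschitzOnWith_of_nnnorm_fderiv_le
      (fun x _ => hw.differentiable one_ne_zero x) fun x hx => ?_⟩
    rw [← NNReal.coe_le_coe, coe_nnnorm]
    exact (hC x hx).trans (Real.le_coe_toNNReal C)
  refine ⟨C, LipschitzWith.of_dist_le_mul ?_⟩
  have key : ∀ x y : E, x ∈ Metric.ball (0 : E) L → y ∉ Metric.ball (0 : E) L →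
      dist (w x) 0 ≤ C * dist x y := by
    intro x y hx hy
    rw [mem_ball_zero_iff] at hx
    rw [mem_ball_zero_iff, not_lt] at hy
    obtain ⟨s, hs, hsL⟩ : ∃ s ∈ Icc (0 : ℝ) 1, ‖x + s • (y - x)‖ = L := by
      apply intermediate_value_Icc zero_le_one
        (f := fun s : ℝ => ‖x + s • (y - x)‖) (by fun_prop)
      simp [hx.le, hy]
    have h1 := hC.dist_le_mul x (by simpa using hx.le) (x + s • (y - x)) (by simp [hsL])
    rw [hw0 _ hsL] at h1
    refine h1.trans (mul_le_mul_of_nonneg_left ?_ C.2)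
    rw [dist_eq_norm, dist_eq_norm, norm_sub_rev x y]
    simp only [sub_add_cancel_left, norm_neg, norm_smul, Real.norm_of_nonneg hs.1]
    exact mul_le_of_le_one_left (norm_nonneg _) hs.2
  intro x y
  by_cases hx : x ∈ Metric.ball (0 : E) L <;> by_cases hy : y ∈ Metric.ball (0 : E) L
  · rw [indicator_of_mem hx, indicator_of_mem hy]
    exact hC.dist_le_mul x (Metric.ball_subset_closedBall hx) y (Metric.ball_subset_closedBall hy)
  · rw [indicator_of_mem hx, indicator_of_notMem hy]
    exact key x y hx hy
  · rw [indicator_of_notMem hx, indicator_of_mem hy, dist_comm, dist_comm x]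
    exact key y x hy hx
  · rw [indicator_of_notMem hx, indicator_of_notMem hy, dist_self]
    positivity

lemma image_ball_add_smul {w : E → E} {L : ℝ} {C : NNReal}
    (hC : LipschitzWith C ((Metric.ball (0 : E) L).indicator w)) {t : ℝ} (ht : 0 ≤ t)
    (htC : t * C < 1) :
    InjOn (fun x => x + t • w x) (Metric.ball (0 : E) L) ∧
      (fun x => x + t • w x) '' Metric.ball (0 : E) L = Metric.ball (0 : E) L := by
  set f : E → E := fun x => x + t • (Metric.ball (0 : E) L).indicator w x with hf
  have hap : ApproximatesLinearOn f ((ContinuousLinearEquiv.refl ℝ E : E ≃L[ℝ] E) : E →L[ℝ] E)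
      univ (t.toNNReal * C) := by
    intro x _ y _
    have h1 := hC.dist_le_mul x y
    rw [dist_eq_norm, dist_eq_norm] at h1
    have : f x - f y - (x - y) = t • ((Metric.ball (0 : E) L).indicator w x
        - (Metric.ball (0 : E) L).indicator w y) := by
      simp only [hf, smul_sub]; abel
    simp only [ContinuousLinearEquiv.coe_refl, ContinuousLinearMap.coe_id', id_eq]
    rw [this, norm_smul, Real.norm_of_nonneg ht, NNReal.coe_mul, Real.coe_toNNReal t ht, mul_assoc]
    exact mul_le_mul_of_nonneg_left h1 ht
  have hc : Subsingleton E ∨ t.toNNReal * C <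
      ‖((ContinuousLinearEquiv.refl ℝ E : E ≃L[ℝ] E).symm : E →L[ℝ] E)‖₊⁻¹ := by
    rcases subsingleton_or_nontrivial E with h | h
    · exact Or.inl h
    · right
      have : ‖((ContinuousLinearEquiv.refl ℝ E : E ≃L[ℝ] E).symm : E →L[ℝ] E)‖₊ = 1 := by
        rw [← NNReal.coe_inj]
        simp only [ContinuousLinearEquiv.refl_symm, ContinuousLinearEquiv.coe_refl, coe_nnnorm]
        exact ContinuousLinearMap.norm_id
      rw [this, inv_one, ← NNReal.coe_lt_coe, NNReal.coe_mul, Real.coe_toNNReal t ht]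
      exact htC
  have hinj : Function.Injective f := injOn_univ.1 (hap.injOn hc)
  have hsurj : Function.Surjective f := hap.surjective hc
  have hin : ∀ x ∈ Metric.ball (0 : E) L, f x = x + t • w x := fun x hx => by
    simp only [hf, indicator_of_mem hx]
  have hout : ∀ x ∉ Metric.ball (0 : E) L, f x = x := fun x hx => by
    simp only [hf, indicator_of_notMem hx, smul_zero, add_zero]
  refine ⟨fun x hx y hy hxy => hinj ?_, Subset.antisymm ?_ ?_⟩
  · rw [hin x hx, hin y hy]; exact hxy
  · rintro _ ⟨x, hx, rfl⟩
    by_contra hy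
    simp only at hy
    rw [← hin x hx] at hy
    have := hinj (hout _ hy)
    rw [this] at hy
    exact hy hx
  · intro y hy
    obtain ⟨x, rfl⟩ := hsurj y
    by_cases hx : x ∈ Metric.ball (0 : E) L
    · exact ⟨x, hx, (hin x hx).symm⟩
    · rw [hout x hx] at hy
      exact absurd hy hx

/-- `t ↦ det (1 + t A)` is a polynomial of degree at most the dimension, so its value at `1` is a
fixed linear combination of its values at given distinct nodes. -/
lemma exists_det_one_add_eq_sum (v : ℕ → ℝ) (hv : Function.Injective v) :
    ∃ c : ℕ → ℝ, (∑ i ∈ Finset.range (Module.finrank ℝ E + 1), c i = 1) ∧ ∀ A : E →L[ℝ] E,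
      (ContinuousLinearMap.id ℝ E + A).det = ∑ i ∈ Finset.range (Module.finrank ℝ E + 1),
        c i * (ContinuousLinearMap.id ℝ E + v i • A).det := by
  classical
  set n := Module.finrank ℝ E
  set s := Finset.range (n + 1)
  refine ⟨fun i => (Lagrange.basis s v i).eval 1, ?_, fun A => ?_⟩
  · have := Lagrange.sum_basis (s := s) (v := v) hv.injOn (by simp [s])
    simpa [Polynomial.eval_finsetSum] using congrArg (Polynomial.eval 1) this
  · set b := Module.finBasis ℝ E
    set M := LinearMap.toMatrix b b (A : E →ₗ[ℝ] E)
    set p : Polynomial ℝ := Matrix.det ((Polynomial.X : Polynomial ℝ) • M.map Polynomial.C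
      + (1 : Matrix (Fin n) (Fin n) ℝ).map Polynomial.C)
    have hp : ∀ t : ℝ, (ContinuousLinearMap.id ℝ E + t • A).det = p.eval t := by
      intro t
      rw [ContinuousLinearMap.det, ← LinearMap.det_toMatrix b]
      simp only [p]
      rw [← Polynomial.coe_evalRingHom, RingHom.map_det]
      congr 1
      ext i j
      simp [M, LinearMap.toMatrix_apply, Matrix.one_apply, add_comm]
      rw [Finsupp.single_apply]
      simp [eq_comm]
      split_ifs <;> simp [mul_comm]
    have hdeg : p.degree < s.card := by
      have := Polynomial.natDegree_det_X_add_C_le M 1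
      simp only [Fintype.card_fin] at this
      refine Polynomial.degree_le_natDegree.trans_lt ?_
      simp only [s, Finset.card_range]
      exact_mod_cast Nat.lt_succ_of_le this
    have h1 := congrArg (Polynomial.eval 1)
      (Lagrange.eq_interpolate (s := s) (v := v) hv.injOn hdeg)
    rw [← one_smul ℝ A, hp, h1, Lagrange.interpolate_apply, Polynomial.eval_finsetSum, one_smul]
    refine Finset.sum_congr rfl fun i _ => ?_
    rw [Polynomial.eval_mul, Polynomial.eval_C, hp, mul_comm]

lemma det_eq_zero_of_norm_eq {r : E → E} {L : ℝ} (hL : 0 < L) (hr : ∀ x, ‖r x‖ = L) {x : E}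
    {A : E →L[ℝ] E} (hA : HasFDerivAt r A x) : A.det = 0 := by
  have h1 : HasFDerivAt (fun y => ‖r y‖ ^ 2) ((2 : ℕ) • (innerSL ℝ (r x)).comp A) x :=
    hA.norm_sq
  have h2 : HasFDerivAt (fun y => ‖r y‖ ^ 2) (0 : E →L[ℝ] ℝ) x := by
    simp only [hr]
    exact hasFDerivAt_const _ _
  have h3 := h1.unique h2
  by_contra hdet
  have hsurj : Function.Surjective A := by
    have hu : IsUnit (LinearMap.det (A : E →ₗ[ℝ] E)) := isUnit_iff_ne_zero.2 hdet
    have := (LinearMap.isUnit_iff_isUnit_det _).2 hu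
    exact ((Module.End.isUnit_iff _).1 this).2
  obtain ⟨y, hy⟩ := hsurj (r x)
  have h4 := DFunLike.congr_fun h3 y
  simp [hy, hr, hL.ne'] at h4

/-- There is no `C¹` retraction of a ball onto its boundary sphere. -/
theorem not_exists_retraction {r : E → E} (hr : ContDiff ℝ 1 r) {L : ℝ} (hL : 0 < L)
    (hrL : ∀ x, ‖r x‖ = L) (hfix : ∀ x, ‖x‖ = L → r x = x) : False := by
  borelize E
  set w : E → E := fun x => r x - x
  have hw : ContDiff ℝ 1 w := hr.sub contDiff_id
  set A : E → E →L[ℝ] E := fderiv ℝ w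
  have hA : Continuous A := hw.continuous_fderiv one_ne_zero
  have hwA : ∀ x, HasFDerivAt w (A x) x :=
    fun x => (hw.differentiable one_ne_zero x).hasFDerivAt
  obtain ⟨C, hC⟩ := exists_lipschitzWith_indicator_ball hw (L := L)
    (fun x hx => by simp [w, hfix x hx])
  set B := Metric.ball (0 : E) L
  have hdetc : Continuous fun p : ℝ × E => (ContinuousLinearMap.id ℝ E + p.1 • A p.2).det :=
    ContinuousLinearMap.continuous_det.comp (by fun_prop)
  have hev : ∀ᶠ t in nhds (0 : ℝ), ∀ x ∈ Metric.closedBall (0 : E) L,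
      0 < (ContinuousLinearMap.id ℝ E + t • A x).det := by
    refine (isCompact_closedBall (0 : E) L).eventually_forall_of_forall_eventually fun x _ => ?_
    refine hdetc.continuousAt.eventually (lt_mem_nhds ?_)
    simp [ContinuousLinearMap.det]
  obtain ⟨δ, hδ, hδB⟩ := Metric.eventually_nhds_iff.1 hev
  set δ' := min (δ / 2) (1 / (C + 1) : ℝ)
  have hδ' : 0 < δ' := lt_min (by positivity) (by positivity)
  have hint : ∀ t : ℝ, IntegrableOn (fun x => (ContinuousLinearMap.id ℝ E + t • A x).det) B
      volume := by
    intro t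
    have : Continuous fun x => (ContinuousLinearMap.id ℝ E + t • A x).det :=
      ContinuousLinearMap.continuous_det.comp (by fun_prop)
    exact (this.continuousOn.integrableOn_compact (isCompact_closedBall (0 : E) L)).mono_set
      Metric.ball_subset_closedBall
  have hvol : ∀ t : ℝ, 0 < t → t < δ' →
      ∫ x in B, (ContinuousLinearMap.id ℝ E + t • A x).det = volume.real B := by
    intro t ht0 ht
    have htC : t * C < 1 := by
      have : t < 1 / (C + 1) := ht.trans_le (min_le_right _ _)
      rw [lt_div_iff₀ (by positivity)] at this
      nlinarith
    obtain ⟨hinj, himg⟩ := image_ball_add_smul hC ht0.le htC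
    have h1 := integral_image_eq_integral_abs_det_fderiv_smul volume
      Metric.isOpen_ball.measurableSet
      (f := fun x => x + t • w x) (f' := fun x => ContinuousLinearMap.id ℝ E + t • A x)
      (fun x _ => ((hasFDerivAt_id x).add ((hwA x).const_smul t)).hasFDerivWithinAt) hinj
      (fun _ => (1 : ℝ))
    rw [himg] at h1
    simp only [smul_eq_mul, mul_one, integral_const, MeasurableSet.univ, measureReal_restrict_apply,
      univ_inter] at h1
    rw [h1]
    refine setIntegral_congr_fun Metric.isOpen_ball.measurableSet fun x hx => ?_
    refine (abs_of_pos (hδB ?_ x (Metric.ball_subset_closedBall hx))).symm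
    rw [Real.dist_eq, sub_zero, abs_of_pos ht0]
    exact ht.trans (by linarith [min_le_left (δ / 2) (1 / (C + 1) : ℝ)])
  have hv : Function.Injective fun i : ℕ => δ' / ((i : ℝ) + 2) := by
    intro i j hij
    simp only at hij
    have hi : ((i : ℝ) + 2) ≠ 0 := by positivity
    have hj : ((j : ℝ) + 2) ≠ 0 := by positivity
    rw [div_eq_div_iff hi hj] at hij
    have := mul_left_cancel₀ hδ'.ne' hij
    exact_mod_cast (add_right_cancel this).symm
  obtain ⟨c, hc1, hc⟩ := exists_det_one_add_eq_sum (E := E) _ hv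
  have h0 : ∫ x in B, (ContinuousLinearMap.id ℝ E + A x).det = 0 := by
    rw [← integral_zero E ℝ (μ := volume.restrict B)]
    refine setIntegral_congr_fun Metric.isOpen_ball.measurableSet fun x _ => ?_
    refine det_eq_zero_of_norm_eq hL hrL (x := x) ?_
    have h2 : r = id + w := by ext; simp [w]
    rw [h2]
    exact (hasFDerivAt_id x).add (hwA x)
  have h1 : ∫ x in B, (ContinuousLinearMap.id ℝ E + A x).det = volume.real B := by
    have h2 := fun x => hc (A x)
    simp only [h2]
    rw [integral_finsetSum _ fun i _ => (hint _).const_mul _]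
    simp_rw [integral_const_mul]
    rw [← one_mul (volume.real B), ← hc1, Finset.sum_mul]
    refine Finset.sum_congr rfl fun i _ => ?_
    rw [hvol _ (by positivity)]
    exact div_lt_self hδ' (by have : (0:ℝ) ≤ i := i.cast_nonneg
                              linarith)
  have : 0 < volume.real B :=
    ENNReal.toReal_pos (Metric.measure_ball_pos volume 0 hL).ne' measure_ball_lt_top.ne
  linarith

/-- Brouwer's fixed point theorem for bounded continuous self-maps of a Euclidean space. -/
theorem exists_fixedPoint_of_bounded {f : E → E} (hf : Continuous f) {ρ : ℝ}
    (hb : ∀ x, ‖f x‖ ≤ ρ) : ∃ x, f x = x := by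
  by_contra! hne
  have hρ : 0 ≤ ρ := (norm_nonneg _).trans (hb 0)
  set L := ρ + 2
  set χ : E → ℝ := fun x => max 0 (min 1 (L - ‖x‖))
  have hχ : Continuous χ := by fun_prop
  have hχ0 : ∀ x, 0 ≤ χ x := fun x => le_max_left _ _
  have hχ1 : ∀ x, χ x ≤ 1 := fun x => max_le zero_le_one (min_le_left _ _)
  have hne' : ∀ x, 0 < ‖x - χ x • f x‖ := by
    intro x
    rw [norm_pos_iff, sub_ne_zero]
    intro hx
    rcases le_total ‖x‖ (ρ + 1) with h | h
    · have : χ x = 1 := by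
        simp only [χ, L]
        rw [min_eq_left (by linarith), max_eq_right zero_le_one]
      rw [this, one_smul] at hx
      exact hne x hx.symm
    · have : ‖x‖ ≤ ρ := by
        rw [hx, norm_smul, Real.norm_of_nonneg (hχ0 x)]
        exact (mul_le_mul (hχ1 x) (hb x) (norm_nonneg _) zero_le_one).trans (one_mul _).le
      linarith
  obtain ⟨g, hg, hgd, hgs⟩ := (hχ.smul hf).exists_contDiff_approx 1
    (ε := fun x => ‖x - χ x • f x‖) (by fun_prop) hne'
  have hF : ∀ x, x - g x ≠ 0 := by
    intro x hx
    have := hgd x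
    rw [← sub_eq_zero.1 hx, dist_eq_norm] at this
    exact lt_irrefl _ this
  have hL : 0 < L := by positivity
  refine not_exists_retraction (r := fun x => (L / ‖x - g x‖) • (x - g x)) ?_ hL ?_ ?_
  · have hd : ContDiff ℝ 1 fun x => x - g x := contDiff_id.sub (by simpa using hg)
    exact (contDiff_const.div (hd.norm ℝ hF) fun x => norm_ne_zero_iff.2 (hF x)).smul hd
  · intro x
    have := norm_pos_iff.2 (hF x)
    rw [norm_smul, Real.norm_of_nonneg (by positivity)]
    field_simp
  · intro x hx
    have hgx : g x = 0 := by
      have : x ∉ Function.support g := fun h => hgs h (by simp [χ, hx])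
      simpa using this
    simp [hgx, hx, hL.ne']

end Brouwer

section Schauder

variable {X : Type*} [NormedAddCommGroup X] [NormedSpace ℝ X] {f : X → X} {K : Set X}

lemma exists_dist_map_le (hf : Continuous f) (hK : IsCompact K) (hfK : ∀ x, f x ∈ K) {ε : ℝ}
    (hε : 0 < ε) : ∃ x, dist x (f x) ≤ ε := by
  classical
  obtain ⟨t, -, htf, htc⟩ := hK.finite_cover_balls hε
  lift t to Finset X using htf
  set φ : t → X → ℝ := fun i y => max 0 (ε - dist y i)
  have hφ : ∀ i, Continuous (φ i) := fun i => by fun_prop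
  have hφ0 : ∀ i y, 0 ≤ φ i y := fun i y => le_max_left _ _
  set S : X → ℝ := fun y => ∑ i, φ i y
  have hS : ∀ x, 0 < S (f x) := by
    intro x
    obtain ⟨i, hi, hxi⟩ := mem_iUnion₂.1 (htc (hfK x))
    refine Finset.sum_pos' (fun i _ => hφ0 i _) ⟨⟨i, hi⟩, Finset.mem_univ _, ?_⟩
    exact lt_max_of_lt_right (sub_pos.2 hxi)
  have hSc : Continuous S := continuous_finsetSum _ fun i _ => hφ i
  set P : EuclideanSpace ℝ t → X := fun w => ∑ i, w i • (i : X)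
  have hP : Continuous P := by fun_prop
  set G : EuclideanSpace ℝ t → EuclideanSpace ℝ t :=
    fun w => WithLp.toLp 2 fun i => φ i (f (P w)) / S (f (P w))
  have hG : Continuous G := by
    refine (PiLp.continuous_toLp 2 _).comp (continuous_pi fun i => ?_)
    exact ((hφ i).comp (hf.comp hP)).div (hSc.comp (hf.comp hP)) fun w => (hS _).ne'
  have hGb : ∀ w, ‖G w‖ ≤ √(t.card : ℝ) := by
    intro w
    rw [EuclideanSpace.norm_eq]
    apply Real.sqrt_le_sqrt
    calc ∑ i, ‖G w i‖ ^ 2 ≤ ∑ i : t, (1 : ℝ) := by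
          refine Finset.sum_le_sum fun i _ => ?_
          have h0 : 0 ≤ φ i (f (P w)) / S (f (P w)) := div_nonneg (hφ0 _ _) (hS _).le
          have h1 : φ i (f (P w)) / S (f (P w)) ≤ 1 := by
            rw [div_le_one (hS _)]
            exact Finset.single_le_sum (fun j _ => hφ0 j _) (Finset.mem_univ i)
          simp only [G, Real.norm_of_nonneg h0]
          exact pow_le_one₀ h0 h1
      _ = t.card := by simp
  obtain ⟨w, hw⟩ := exists_fixedPoint_of_bounded hG hGb
  refine ⟨P w, ?_⟩
  set y := f (P w)
  have hwi : ∀ i, w i = φ i y / S y := fun i => by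
    conv_lhs => rw [← hw]
  have hsum : ∑ i, w i = 1 := by
    simp_rw [hwi, ← Finset.sum_div]
    exact div_self (hS _).ne'
  have hy : P w - y = ∑ i, w i • ((i : X) - y) := by
    simp only [smul_sub, Finset.sum_sub_distrib, ← Finset.sum_smul, hsum, one_smul, P]
  rw [dist_eq_norm, hy]
  calc ‖∑ i, w i • ((i : X) - y)‖ ≤ ∑ i, w i * ε := by
        refine norm_sum_le_of_le _ fun i _ => ?_
        have hw0 : 0 ≤ w i := by
          rw [hwi]; exact div_nonneg (hφ0 _ _) (hS _).le
        rw [norm_smul, Real.norm_of_nonneg hw0]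
        rcases hw0.eq_or_lt with h | h
        · simp [← h]
        · refine mul_le_mul_of_nonneg_left ?_ hw0
          by_contra! hlt
          rw [← dist_eq_norm, dist_comm] at hlt
          rw [hwi, show φ i y = 0 from max_eq_left (by linarith), zero_div] at h
          exact lt_irrefl _ h
    _ = ε := by rw [← Finset.sum_mul, hsum, one_mul]

/-- Schauder's fixed point theorem, for continuous self-maps of a normed space whose range lies
in a compact set. -/
theorem exists_fixedPoint_of_isCompact (hf : Continuous f) (hK : IsCompact K)
    (hfK : ∀ x, f x ∈ K) : ∃ x, f x = x := by
  choose x hx using fun n : ℕ => exists_dist_map_le hf hK hfK (Nat.one_div_pos_of_nat (n := n))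
  obtain ⟨z, -, ψ, hψ, hz⟩ := hK.tendsto_subseq fun n => hfK (x n)
  have hxz : Tendsto (x ∘ ψ) atTop (nhds z) := by
    refine hz.congr_dist (squeeze_zero (fun _ => dist_nonneg) (fun n => ?_)
      ((tendsto_one_div_add_atTop_nhds_zero_nat (𝕜 := ℝ)).comp hψ.tendsto_atTop))
    rw [dist_comm]
    exact hx (ψ n)
  exact ⟨z, tendsto_nhds_unique ((hf.tendsto z).comp hxz) hz⟩

end Schauder

section PeriodicProblem

lemma isCompact_setOf_modulus {I : Type*} [TopologicalSpace I] [CompactSpace I] (C : ℝ)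
    {ω : I → I → ℝ} (hω : ∀ s, Continuous (ω s)) (hω0 : ∀ s, ω s s = 0) :
    IsCompact {f : C(I, ℝ) | (∀ t, |f t| ≤ C) ∧ ∀ s t, |f s - f t| ≤ ω s t} := by
  have hequi : ∀ S : Set (I → ℝ), (∀ f ∈ S, ∀ s t, |f s - f t| ≤ ω s t) →
      Equicontinuous ((↑) : S → I → ℝ) := by
    intro S hS s
    rw [Metric.equicontinuousAt_iff_right]
    intro ε hε
    have : ∀ᶠ t in nhds s, ω s t < ε := (hω s).continuousAt.eventually (gt_mem_nhds (by
      rw [hω0]; exact hε))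
    filter_upwards [this] with t ht f
    rw [Real.dist_eq]
    exact (hS f f.2 s t).trans_lt ht
  refine ArzelaAscoli.isCompact_of_equicontinuous _ ?_ ?_
  · have himg : ContinuousMap.toFun '' {f : C(I, ℝ) | (∀ t, |f t| ≤ C) ∧
        ∀ s t, |f s - f t| ≤ ω s t} =
        {f : I → ℝ | (∀ t, |f t| ≤ C) ∧ ∀ s t, |f s - f t| ≤ ω s t} := by
      ext f
      constructor
      · rintro ⟨f, hf, rfl⟩
        exact hf
      · intro hf
        have h1 := hequi {f} (by rintro _ rfl; exact hf.2)
        exact ⟨⟨f, h1.continuous ⟨f, rfl⟩⟩, hf, rfl⟩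
    rw [himg]
    refine (isCompact_univ_pi fun _ : I => isCompact_Icc (a := -C) (b := C)).of_isClosed_subset
      ?_ fun f hf t _ => abs_le.1 (hf.1 t)
    simp only [ofPred_and, ofPred_forall]
    refine (isClosed_iInter fun t => isClosed_le (by fun_prop) (by fun_prop)).inter
      (isClosed_iInter fun s => isClosed_iInter fun t => isClosed_le (by fun_prop) (by fun_prop))
  · have := hequi (ContinuousMap.toFun '' {f : C(I, ℝ) | (∀ t, |f t| ≤ C) ∧
        ∀ s t, |f s - f t| ≤ ω s t}) (by rintro _ ⟨f, hf, rfl⟩; exact hf.2)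
    intro s U hU
    filter_upwards [this s U hU] with t ht f
    exact ht ⟨_, f, f.2, rfl⟩

variable {T : ℝ} (hT : 0 < T)

/-- The primitive `t ↦ ∫₀ᵗ a f` of a continuous function on `[0, T]`, with weight `a`. -/
def weightedPrimitive {a : ℝ → ℝ} (ha : ∀ x y, IntervalIntegrable a volume x y)
    (f : C(Icc 0 T, ℝ)) :
    C(Icc 0 T, ℝ) where
  toFun t := ∫ s in (0 : ℝ)..t, a s * IccExtend hT.le f s
  continuous_toFun := by
    refine (intervalIntegral.continuous_primitive (fun x y => ?_) 0).comp continuous_subtype_val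
    exact (ha x y).mul_continuousOn (f.continuous.Icc_extend').continuousOn

lemma abs_weightedPrimitive_sub_le {a : ℝ → ℝ} (ha : ∀ x y, IntervalIntegrable a volume x y)
    {f : C(Icc 0 T, ℝ)} {C : ℝ} (hC : ∀ t, |f t| ≤ C) (s t : Icc 0 T) :
    |weightedPrimitive hT ha f s - weightedPrimitive hT ha f t| ≤
      C * |(∫ x in (0 : ℝ)..s, ‖a x‖) - ∫ x in (0 : ℝ)..t, ‖a x‖| := by
  have hi' : ∀ x y, IntervalIntegrable (fun s => a s * IccExtend hT.le f s) volume x y :=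
    fun x y => (ha x y).mul_continuousOn (f.continuous.Icc_extend').continuousOn
  simp only [weightedPrimitive, ContinuousMap.coe_mk]
  rw [intervalIntegral.integral_interval_sub_left (hi' _ _) (hi' _ _),
    intervalIntegral.integral_interval_sub_left (ha _ _).norm (ha _ _).norm,
    ← abs_of_nonneg ((abs_nonneg _).trans (hC s)), ← abs_mul,
    ← intervalIntegral.integral_const_mul]
  refine intervalIntegral.norm_integral_le_abs_of_norm_le (f := fun s => a s * IccExtend hT.le f s)
    (ae_of_all _ fun x => ?_) ((ha _ _).norm.const_mul _)
  rw [norm_mul, mul_comm]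
  exact mul_le_mul_of_nonneg_right (hC _) (norm_nonneg _)

lemma continuous_weightedPrimitive {a : ℝ → ℝ} (ha : ∀ x y, IntervalIntegrable a volume x y) :
    Continuous (weightedPrimitive hT ha) := by
  set D := ∫ x in (0 : ℝ)..T, ‖a x‖
  refine (LipschitzWith.of_dist_le_mul (K := D.toNNReal) fun f g => ?_).continuous
  rw [ContinuousMap.dist_le (by positivity)]
  intro t
  have hsub : weightedPrimitive hT ha f t - weightedPrimitive hT ha g t =
      weightedPrimitive hT ha (f - g) t -
        weightedPrimitive hT ha (f - g) ⟨0, left_mem_Icc.2 hT.le⟩ := by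
    simp only [weightedPrimitive, ContinuousMap.coe_mk, intervalIntegral.integral_same, sub_zero]
    rw [← intervalIntegral.integral_sub]
    · exact intervalIntegral.integral_congr fun x _ => by simp [IccExtend, mul_sub]
    · exact (ha _ _).mul_continuousOn (f.continuous.Icc_extend').continuousOn
    · exact (ha _ _).mul_continuousOn (g.continuous.Icc_extend').continuousOn
  have hle : |∫ x in (0 : ℝ)..t, ‖a x‖| ≤ D := by
    rw [abs_of_nonneg (intervalIntegral.integral_nonneg t.2.1 fun _ _ => norm_nonneg _)]
    exact intervalIntegral.integral_mono_interval le_rfl t.2.1 t.2.2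
      (ae_of_all _ fun _ => norm_nonneg _) (ha _ _).norm
  rw [Real.dist_eq, hsub]
  refine (abs_weightedPrimitive_sub_le hT ha (C := dist f g) (fun s => ?_) _ _).trans ?_
  · exact (ContinuousMap.dist_apply_le_dist (f := f) (g := g) s)
  · simp only [intervalIntegral.integral_same, sub_zero]
    rw [mul_comm]
    exact mul_le_mul_of_nonneg_right (hle.trans (Real.le_coe_toNNReal D)) dist_nonneg

/-- Existence for a periodic problem `u' = h(t, v)`, `v = v(0) + Φ(u)` with a compact nonlinear
operator `Φ` that points inwards on large constant-sign functions. -/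
theorem exists_periodic_of_compact_operator {h : ℝ → ℝ → ℝ}
    (hhc : Continuous (Function.uncurry h)) (hh0 : ∀ t, h t 0 = 0) (hh1 : ∀ t, StrictMono (h t))
    {Φ : C(Icc 0 T, ℝ) → C(Icc 0 T, ℝ)} (hΦ : Continuous Φ)
    (hΦ0 : ∀ u, Φ u ⟨0, left_mem_Icc.2 hT.le⟩ = 0)
    {ω : Icc 0 T → Icc 0 T → ℝ} (hω : ∀ s, Continuous (ω s)) (hω0 : ∀ s, ω s s = 0)
    (hΦω : ∀ u s t, |Φ u s - Φ u t| ≤ ω s t)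
    {C₀ : ℝ} (hpos : ∀ u, (∀ t, C₀ ≤ u t) → Φ u ⟨T, right_mem_Icc.2 hT.le⟩ < 0)
    (hneg : ∀ u, (∀ t, u t ≤ -C₀) → 0 < Φ u ⟨T, right_mem_Icc.2 hT.le⟩) :
    ∃ u v : C(Icc 0 T, ℝ),
      (∀ t : Icc 0 T, u t = u ⟨0, left_mem_Icc.2 hT.le⟩ +
        ∫ s in (0 : ℝ)..t, h s (IccExtend hT.le v s)) ∧
      (∀ t, v t = v ⟨0, left_mem_Icc.2 hT.le⟩ + Φ u t) ∧
      u ⟨T, right_mem_Icc.2 hT.le⟩ = u ⟨0, left_mem_Icc.2 hT.le⟩ ∧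
      v ⟨T, right_mem_Icc.2 hT.le⟩ = v ⟨0, left_mem_Icc.2 hT.le⟩ := by
  set z₀ : Icc 0 T := ⟨0, left_mem_Icc.2 hT.le⟩
  set z₁ : Icc 0 T := ⟨T, right_mem_Icc.2 hT.le⟩
  obtain ⟨Q, hQ⟩ := isCompact_univ.exists_bound_of_continuousOn (hω z₀).continuousOn
  have hQ : ∀ u t, |Φ u t| ≤ Q := fun u t => by
    have := hΦω u z₀ t
    rw [hΦ0, zero_sub, abs_neg] at this
    exact this.trans ((le_abs_self _).trans (hQ t (mem_univ _)))
  have hQ0 : 0 ≤ Q := (abs_nonneg _).trans (hQ 0 z₀)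
  set clip : ℝ → ℝ → ℝ := fun R x => max (-R) (min R x)
  have hclip : ∀ R, Continuous (clip R) := fun R => by fun_prop
  have hclip_abs : ∀ R x, 0 ≤ R → |clip R x| ≤ R := fun R x hR =>
    abs_le.2 ⟨le_max_left _ _, max_le (by linarith) (min_le_left _ _)⟩
  have hclip_eq : ∀ R x, |x| ≤ R → clip R x = x := fun R x hx => by
    rw [abs_le] at hx
    simp only [clip]
    rw [min_eq_right hx.2, max_eq_right hx.1]
  have hclip_fix : ∀ R x d, 0 < R → x = clip R (x + d) →
      d = 0 ∨ (x = R ∧ 0 ≤ d) ∨ (x = -R ∧ d ≤ 0) := by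
    intro R x d hR hx
    simp only [clip] at hx
    rcases le_total R (x + d) with h1 | h1
    · rw [min_eq_left h1, max_eq_right (by linarith)] at hx
      exact Or.inr (Or.inl ⟨hx, by linarith⟩)
    · rw [min_eq_right h1] at hx
      rcases le_total (-R) (x + d) with h2 | h2
      · rw [max_eq_right h2] at hx
        exact Or.inl (by linarith)
      · rw [max_eq_left h2] at hx
        exact Or.inr (Or.inr ⟨hx, by linarith⟩)
  set V := 4 * Q + 1
  have hHc : Continuous fun p : Icc 0 T × ℝ => h p.1 (clip V p.2) := by
    have := hclip V
    exact hhc.comp (by fun_prop : Continuous fun p : Icc 0 T × ℝ => ((p.1 : ℝ), clip V p.2))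
  set H : C(Icc 0 T, ℝ) → C(Icc 0 T, ℝ) := fun v =>
    ⟨fun t => h t (clip V (v t)), hHc.comp (continuous_id.prodMk v.continuous)⟩
  have hH : Continuous H := by
    refine ContinuousMap.continuous_of_continuous_uncurry _ ?_
    exact hHc.comp (by fun_prop : Continuous fun p : C(Icc 0 T, ℝ) × Icc 0 T => (p.2, p.1 p.2))
  obtain ⟨B, hB⟩ : ∃ B, ∀ v t, |H v t| ≤ B := by
    obtain ⟨B, hB⟩ := (isCompact_Icc.prod isCompact_Icc :
      IsCompact (Icc 0 T ×ˢ Icc (-V) V)).exists_bound_of_continuousOn hhc.continuousOn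
    exact ⟨B, fun v t => hB (t, clip V (v t))
      ⟨t.2, abs_le.1 (hclip_abs V (v t) (by positivity))⟩⟩
  have hB0 : 0 ≤ B := (abs_nonneg _).trans (hB 0 z₀)
  have h1i : ∀ x y, IntervalIntegrable (fun _ => (1 : ℝ)) volume x y := fun x y => by simp
  set W : C(Icc 0 T, ℝ) → C(Icc 0 T, ℝ) := fun v => weightedPrimitive hT h1i (H v)
  have hW : Continuous W := (continuous_weightedPrimitive hT h1i).comp hH
  have hW0 : ∀ v, W v z₀ = 0 := fun v => by simp [W, weightedPrimitive, z₀]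
  have hWmod : ∀ v s t, |W v s - W v t| ≤ B * |(s : ℝ) - t| := fun v s t => by
    simpa using abs_weightedPrimitive_sub_le hT h1i (hB v) s t
  have hWB : ∀ v t, |W v t| ≤ B * T := fun v t => by
    have := hWmod v t z₀
    rw [hW0, sub_zero] at this
    refine this.trans (mul_le_mul_of_nonneg_left ?_ hB0)
    simp only [z₀, sub_zero]
    rw [abs_of_nonneg t.2.1]
    exact t.2.2
  set R₁ := |C₀| + B * T + 1
  set R₂ := 2 * Q + 1
  have hR₁ : 0 < R₁ := by positivity
  have hR₂ : 0 < R₂ := by positivity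
  set Ψ₁ : C(Icc 0 T, ℝ) × C(Icc 0 T, ℝ) → C(Icc 0 T, ℝ) := fun p =>
    ⟨fun t => clip R₁ (p.1 z₀ + Φ p.1 z₁) + W p.2 t, by fun_prop⟩
  set Ψ₂ : C(Icc 0 T, ℝ) × C(Icc 0 T, ℝ) → C(Icc 0 T, ℝ) := fun p =>
    ⟨fun t => clip R₂ (p.2 z₀ + -W p.2 z₁) + (Φ p.1 t - Φ p.1 z₁ * (t / T)), by fun_prop⟩
  have hΨ₁ : Continuous Ψ₁ := by
    refine ContinuousMap.continuous_of_continuous_uncurry _ ?_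
    have := hclip R₁
    simp only [Ψ₁, Function.uncurry_def, ContinuousMap.coe_mk]
    fun_prop
  have hΨ₂ : Continuous Ψ₂ := by
    refine ContinuousMap.continuous_of_continuous_uncurry _ ?_
    have := hclip R₂
    simp only [Ψ₂, Function.uncurry_def, ContinuousMap.coe_mk]
    fun_prop
  have htT : ∀ t : Icc 0 T, |(t : ℝ) / T| ≤ 1 := fun t => by
    rw [abs_of_nonneg (div_nonneg t.2.1 hT.le), div_le_one hT]
    exact t.2.2
  have hq : ∀ u t, |Φ u t - Φ u z₁ * (t / T)| ≤ 2 * Q := fun u t => by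
    refine (abs_sub _ _).trans ?_
    rw [abs_mul]
    have := mul_le_mul (hQ u z₁) (htT t) (abs_nonneg _) hQ0
    linarith [hQ u t]
  have hK₁ := isCompact_setOf_modulus (R₁ + B * T) (ω := fun s t : Icc 0 T => B * |(s : ℝ) - t|)
    (fun s => by fun_prop) (fun s => by simp)
  have hK₂ := isCompact_setOf_modulus (R₂ + 2 * Q)
    (ω := fun s t : Icc 0 T => ω s t + Q * |(s : ℝ) / T - t / T|)
    (fun s => (hω s).add (by fun_prop)) (fun s => by simp [hω0])
  obtain ⟨⟨u, v⟩, huv⟩ := exists_fixedPoint_of_isCompact (f := fun p => (Ψ₁ p, Ψ₂ p))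
    (hΨ₁.prodMk hΨ₂) (hK₁.prod hK₂) (fun p => by
      refine ⟨⟨fun t => ?_, fun s t => ?_⟩, ⟨fun t => ?_, fun s t => ?_⟩⟩
      · exact (abs_add_le _ _).trans (add_le_add (hclip_abs _ _ hR₁.le) (hWB _ _))
      · simp only [Ψ₁, ContinuousMap.coe_mk, add_sub_add_left_eq_sub]
        exact hWmod _ _ _
      · exact (abs_add_le _ _).trans (add_le_add (hclip_abs _ _ hR₂.le) (hq _ _))
      · simp only [Ψ₂, ContinuousMap.coe_mk, add_sub_add_left_eq_sub]
        have e : Φ p.1 s - Φ p.1 z₁ * (s / T) - (Φ p.1 t - Φ p.1 z₁ * (t / T)) =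
          (Φ p.1 s - Φ p.1 t) - Φ p.1 z₁ * (s / T - t / T) := by ring
        rw [e]
        refine (abs_sub _ _).trans (add_le_add (hΦω _ _ _) ?_)
        rw [abs_mul]
        exact mul_le_mul_of_nonneg_right (hQ _ _) (abs_nonneg _))
  obtain ⟨hu, hv⟩ := Prod.mk.inj huv
  have hu' : ∀ t, u t = clip R₁ (u z₀ + Φ u z₁) + W v t := fun t => by
    conv_lhs => rw [← hu]
    rfl
  have hv' : ∀ t, v t = clip R₂ (v z₀ + -W v z₁) + (Φ u t - Φ u z₁ * (t / T)) := fun t => by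
    conv_lhs => rw [← hv]
    rfl
  have hu0 : u z₀ = clip R₁ (u z₀ + Φ u z₁) := by simpa [hW0] using hu' z₀
  have hv0 : v z₀ = clip R₂ (v z₀ + -W v z₁) := by simpa [hΦ0, z₀] using hv' z₀
  have hut : ∀ t, u t = u z₀ + W v t := fun t => by rw [hu' t, ← hu0]
  have hvt : ∀ t, v t = v z₀ + (Φ u t - Φ u z₁ * (t / T)) := fun t => by rw [hv' t, ← hv0]
  have hΦ1 : Φ u z₁ = 0 := by
    rcases hclip_fix R₁ (u z₀) _ hR₁ hu0 with h1 | ⟨h1, h2⟩ | ⟨h1, h2⟩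
    · exact h1
    · refine absurd h2 (not_le.2 (hpos u fun t => ?_))
      rw [hut, h1]
      have := (abs_le.1 (hWB v t)).1
      have := le_abs_self C₀
      simp only [R₁]; linarith
    · refine absurd h2 (not_le.2 (hneg u fun t => ?_))
      rw [hut, h1]
      have := (abs_le.1 (hWB v t)).2
      have := le_abs_self C₀
      simp only [R₁]; linarith
  have hvV : ∀ t, |v t| ≤ V := fun t => by
    rw [hv' t]
    refine (abs_add_le _ _).trans ((add_le_add (hclip_abs _ _ hR₂.le) (hq _ _)).trans ?_)
    simp only [R₂, V]; linarith
  have hWv : ∀ t : Icc 0 T, W v t = ∫ s in (0 : ℝ)..t, h s (IccExtend hT.le v s) := fun t => by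
    simp only [W, weightedPrimitive, ContinuousMap.coe_mk]
    refine intervalIntegral.integral_congr fun s hs => ?_
    rw [uIcc_of_le t.2.1] at hs
    have hs' : s ∈ Icc 0 T := ⟨hs.1, hs.2.trans t.2.2⟩
    simp [H, IccExtend_of_mem _ _ hs', hclip_eq _ _ (hvV _)]
  have hcont : Continuous fun s => h s (IccExtend hT.le v s) :=
    hhc.comp (continuous_id.prodMk v.continuous.Icc_extend')
  have hW1 : W v z₁ = 0 := by
    rcases hclip_fix R₂ (v z₀) _ hR₂ hv0 with h1 | ⟨h1, h2⟩ | ⟨h1, h2⟩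
    · linarith
    · have hp : 0 < W v z₁ := by
        rw [hWv]
        refine intervalIntegral.intervalIntegral_pos_of_pos (hcont.intervalIntegrable _ _)
          (fun s => ?_) hT
        refine (hh0 s).symm.trans_lt (hh1 s ?_)
        rw [IccExtend, Function.comp_apply, hvt, h1]
        have := (abs_le.1 (hq u (projIcc 0 T hT.le s))).1
        simp only [R₂]; linarith
      linarith
    · have hp : W v z₁ < 0 := by
        rw [hWv, ← neg_pos, ← intervalIntegral.integral_neg]
        refine intervalIntegral.intervalIntegral_pos_of_pos (hcont.neg.intervalIntegrable _ _)
          (fun s => ?_) hT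
        rw [neg_pos]
        refine (hh1 s ?_).trans_eq (hh0 s)
        rw [IccExtend, Function.comp_apply, hvt, h1]
        have := (abs_le.1 (hq u (projIcc 0 T hT.le s))).2
        simp only [R₂]; linarith
      linarith
  refine ⟨u, v, fun t => by rw [hut, hWv], fun t => by rw [hvt, hΦ1]; ring, ?_, ?_⟩
  · rw [hut z₁, hW1, add_zero]
  · rw [hvt z₁, hΦ1]; ring

end PeriodicProblem

section PeriodicExtension

lemma exists_periodic_extension {T : ℝ} (hT : 0 < T) {f : ℝ → ℝ} (hf : ContinuousOn f (Icc 0 T))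
    (h0 : f 0 = f T) :
    ∃ F : ℝ → ℝ, Continuous F ∧ Function.Periodic F T ∧ ∀ t ∈ Icc 0 T, F t = f t := by
  have : Fact (0 < T) := ⟨hT⟩
  have hper : Function.Periodic (fun t : ℝ => AddCircle.liftIco T 0 f (t : AddCircle T)) T :=
    fun t => by
    simp
  have hIco : ∀ t ∈ Ico 0 T, AddCircle.liftIco T 0 f (t : AddCircle T) = f t := fun t ht =>
    AddCircle.liftIco_zero_coe_apply ht
  refine ⟨_, (AddCircle.liftIco_zero_continuous h0 hf).comp (AddCircle.continuous_mk' T), hper,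
    fun t ht => ?_⟩
  rcases ht.2.eq_or_lt with rfl | h
  · have := hper 0
    simp only [zero_add] at this
    exact this.trans ((hIco 0 ⟨le_rfl, hT⟩).trans h0)
  · exact hIco t ⟨ht.1, h⟩

lemma eq_add_integral_of_periodic {T : ℝ} (hT : 0 < T) {F p : ℝ → ℝ} (hF : Function.Periodic F T)
    (hp : Function.Periodic p T) (hpi : ∀ x y, IntervalIntegrable p volume x y)
    (h : ∀ t ∈ Icc 0 T, F t = F 0 + ∫ s in (0 : ℝ)..t, p s) (t : ℝ) :
    F t = F 0 + ∫ s in (0 : ℝ)..t, p s := by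
  have hz : ∫ s in (0 : ℝ)..T, p s = 0 := by
    have h1 := h T ⟨hT.le, le_rfl⟩
    have h2 := hF 0
    rw [zero_add] at h2
    linarith
  have hper : Function.Periodic (fun t => F t - ∫ s in (0 : ℝ)..t, p s) T := fun t => by
    have h1 := hp.intervalIntegral_add_eq t 0
    rw [zero_add, hz] at h1
    have h2 := intervalIntegral.integral_add_adjacent_intervals (hpi 0 t) (hpi t (t + T))
    simp only [hF t]
    linarith
  obtain ⟨y, hy, hty⟩ := hper.exists_mem_Ico₀ hT t
  have := h y ⟨hy.1, hy.2.le⟩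
  linarith

/-- The periodic problem `u' = h(t, v)`, `v' = -a(t) g(u) + β(max u) - α(max u) b(t)` has a
solution as soon as `v'` has the right mean on large constant-sign functions. -/
theorem exists_periodic_modified {T : ℝ} (hT : 0 < T) {h : ℝ → ℝ → ℝ}
    (hhc : Continuous (Function.uncurry h)) (hhper : ∀ t s, h (t + T) s = h t s)
    (hh0 : ∀ t, h t 0 = 0) (hh1 : ∀ t, StrictMono (h t)) {a b : ℝ → ℝ}
    (ha : ∀ x y, IntervalIntegrable a volume x y) (hb : ∀ x y, IntervalIntegrable b volume x y)
    (haper : Function.Periodic a T) (hbper : Function.Periodic b T)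
    {g α β : ℝ → ℝ} (hg : Continuous g) (hα : Continuous α) (hβ : Continuous β) {B : ℝ}
    (hgB : ∀ x, |g x| ≤ B) (hαB : ∀ x, |α x| ≤ B) (hβB : ∀ x, |β x| ≤ B) {C₀ y₀ y₁ : ℝ}
    (hg₀ : ∀ x ≤ -C₀, g x = y₀) (hg₁ : ∀ x, C₀ ≤ x → g x = y₁)
    (h₀ : ∀ x ≤ -C₀, 0 < -y₀ * (∫ t in (0 : ℝ)..T, a t) + β x * T - α x * ∫ t in (0 : ℝ)..T, b t)
    (h₁ : ∀ x, C₀ ≤ x →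
      -y₁ * (∫ t in (0 : ℝ)..T, a t) + β x * T - α x * (∫ t in (0 : ℝ)..T, b t) < 0) :
    ∃ u v : ℝ → ℝ, ∃ z : ℝ, Continuous u ∧ Continuous v ∧ Function.Periodic u T ∧
      Function.Periodic v T ∧ (∀ t, u t ≤ u z) ∧
      (∀ t, u t = u 0 + ∫ s in (0 : ℝ)..t, h s (v s)) ∧
      ∀ t, v t = v 0 + ∫ s in (0 : ℝ)..t, (-(a s * g (u s)) + β (u z) - α (u z) * b s) := by
  have : Nonempty (Icc 0 T) := ⟨⟨0, left_mem_Icc.2 hT.le⟩⟩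
  have h1i : ∀ x y, IntervalIntegrable (fun _ => (1 : ℝ)) volume x y := fun x y => by simp
  have hmax : ∀ u : C(Icc 0 T, ℝ), ∃ z, ∀ t, u t ≤ u z := fun u => by
    obtain ⟨z, -, hz⟩ := isCompact_univ.exists_isMaxOn univ_nonempty u.continuous.continuousOn
    exact ⟨z, fun t => hz (mem_univ t)⟩
  choose zm hzm using hmax
  set m : C(Icc 0 T, ℝ) → ℝ := fun u => u (zm u)
  have hmc : Continuous m := by
    refine (LipschitzWith.of_dist_le_mul (K := 1) fun u w => ?_).continuous
    have key : ∀ u w : C(Icc 0 T, ℝ), m u - m w ≤ dist u w := fun u w => by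
      have h1 := (le_abs_self _).trans (ContinuousMap.dist_apply_le_dist (f := u) (g := w) (zm u))
      have h2 := hzm w (zm u)
      simp only [m]
      linarith
    rw [NNReal.coe_one, one_mul, Real.dist_eq, abs_le]
    have := key w u
    rw [dist_comm] at this
    exact ⟨by linarith, key u w⟩
  set gC : C(ℝ, ℝ) := ⟨g, hg⟩
  set Pa := weightedPrimitive hT ha
  set P₁ := weightedPrimitive hT h1i 1
  set Pb := weightedPrimitive hT hb 1
  set Φ : C(Icc 0 T, ℝ) → C(Icc 0 T, ℝ) := fun u =>
    -Pa (gC.comp u) + β (m u) • P₁ - α (m u) • Pb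
  have hΦ : Continuous Φ := by
    have h1 : Continuous fun u : C(Icc 0 T, ℝ) => Pa (gC.comp u) :=
      (continuous_weightedPrimitive hT ha).comp (ContinuousMap.continuous_postcomp gC)
    have h2 : Continuous fun u => β (m u) := hβ.comp hmc
    have h3 : Continuous fun u => α (m u) := hα.comp hmc
    exact (h1.neg.add (h2.smul continuous_const)).sub (h3.smul continuous_const)
  have hΦv : ∀ u t, Φ u t = -(∫ s in (0 : ℝ)..t, a s * g (IccExtend hT.le u s)) + β (m u) * t -
      α (m u) * ∫ s in (0 : ℝ)..t, b s := fun u t => by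
    simp [Φ, Pa, P₁, Pb, weightedPrimitive, gC, IccExtend]
  have hgi : ∀ (u : ℝ → ℝ), Continuous u → ∀ x y,
      IntervalIntegrable (fun s => a s * g (u s)) volume x y :=
    fun u hu x y => (ha x y).mul_continuousOn (hg.comp hu).continuousOn
  have hΦT : ∀ u (y : ℝ), (∀ t, g (u t) = y) → Φ u ⟨T, right_mem_Icc.2 hT.le⟩ =
      -y * (∫ t in (0 : ℝ)..T, a t) + β (m u) * T - α (m u) * ∫ t in (0 : ℝ)..T, b t :=
    fun u y hy => by
      rw [hΦv]
      simp only [IccExtend, Function.comp_apply, hy, intervalIntegral.integral_mul_const]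
      ring
  have hB : 0 ≤ B := (abs_nonneg _).trans (hgB 0)
  obtain ⟨u, v, hu, hv, hu1, hv1⟩ := exists_periodic_of_compact_operator hT hhc hh0 hh1 hΦ
    (fun u => by simp [hΦv])
    (ω := fun s t : Icc 0 T => B * |(∫ x in (0 : ℝ)..s, ‖a x‖) - ∫ x in (0 : ℝ)..t, ‖a x‖| +
      B * |(s : ℝ) - t| + B * |(∫ x in (0 : ℝ)..s, ‖b x‖) - ∫ x in (0 : ℝ)..t, ‖b x‖|)
    (fun s => by
      have h1 : Continuous fun t : Icc 0 T => ∫ x in (0 : ℝ)..t, ‖a x‖ :=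
        (intervalIntegral.continuous_primitive (fun x y => (ha x y).norm) 0).comp
          continuous_subtype_val
      have h2 : Continuous fun t : Icc 0 T => ∫ x in (0 : ℝ)..t, ‖b x‖ :=
        (intervalIntegral.continuous_primitive (fun x y => (hb x y).norm) 0).comp
          continuous_subtype_val
      fun_prop)
    (fun s => by simp)
    (fun u s t => by
      have h1 := abs_weightedPrimitive_sub_le hT ha (f := gC.comp u) (fun t => hgB (u t)) s t
      have h2 := abs_weightedPrimitive_sub_le hT h1i (f := 1) (C := 1) (fun t => by simp) s t
      have h3 := abs_weightedPrimitive_sub_le hT hb (f := 1) (C := 1) (fun t => by simp) s t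
      have e : Φ u s - Φ u t = -(Pa (gC.comp u) s - Pa (gC.comp u) t) +
          β (m u) * (P₁ s - P₁ t) - α (m u) * (Pb s - Pb t) := by
        simp [Φ]; ring
      rw [e]
      refine (abs_sub _ _).trans (add_le_add ((abs_add_le _ _).trans (add_le_add ?_ ?_)) ?_)
      · rwa [abs_neg]
      · rw [abs_mul]
        exact mul_le_mul (hβB _) (by simpa using h2) (abs_nonneg _) hB
      · rw [abs_mul]
        exact mul_le_mul (hαB _) (by simpa using h3) (abs_nonneg _) hB)
    (C₀ := C₀)
    (fun u hu => by
      rw [hΦT u y₁ fun t => hg₁ _ (hu t)]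
      exact h₁ _ (hu _))
    (fun u hu => by
      rw [hΦT u y₀ fun t => hg₀ _ (hu t)]
      exact h₀ _ (hu _))
  obtain ⟨U, hU, hUp, hUe⟩ := exists_periodic_extension hT (f := IccExtend hT.le u)
    u.continuous.Icc_extend'.continuousOn (by rw [IccExtend_left, IccExtend_right]; exact hu1.symm)
  obtain ⟨V, hV, hVp, hVe⟩ := exists_periodic_extension hT (f := IccExtend hT.le v)
    v.continuous.Icc_extend'.continuousOn (by rw [IccExtend_left, IccExtend_right]; exact hv1.symm)
  have hUe' : ∀ t : Icc 0 T, U t = u t := fun t => by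
    rw [hUe t t.2, IccExtend_of_mem _ _ t.2]
  have hVe' : ∀ t : Icc 0 T, V t = v t := fun t => by
    rw [hVe t t.2, IccExtend_of_mem _ _ t.2]
  have hmU : m u = U (zm u) := (hUe' _).symm
  refine ⟨U, V, zm u, hU, hV, hUp, hVp, fun t => ?_, ?_, ?_⟩
  · obtain ⟨y, hy, hty⟩ := hUp.exists_mem_Ico₀ hT t
    rw [hty, hUe' ⟨y, hy.1, hy.2.le⟩, hUe']
    exact hzm u _
  · refine eq_add_integral_of_periodic hT hUp (fun t => by rw [hhper, hVp])
      (fun x y => (hhc.comp (continuous_id.prodMk hV)).intervalIntegrable x y) fun t ht => ?_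
    rw [hUe' ⟨t, ht⟩, hu, hUe' ⟨0, left_mem_Icc.2 hT.le⟩]
    congr 1
    refine intervalIntegral.integral_congr fun s hs => ?_
    rw [uIcc_of_le ht.1] at hs
    simp only [hVe s ⟨hs.1, hs.2.trans ht.2⟩]
  · have hgn : ∀ x y, IntervalIntegrable (fun s => -(a s * g (U s))) volume x y :=
      fun x y => (hgi U hU x y).neg
    refine eq_add_integral_of_periodic hT hVp (fun t => by rw [haper, hbper, hUp])
      (fun x y => ((hgn x y).add intervalIntegrable_const).sub ((hb x y).const_mul _))
      fun t ht => ?_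
    rw [hVe' ⟨t, ht⟩, hv, hVe' ⟨0, left_mem_Icc.2 hT.le⟩, hΦv, hmU,
      intervalIntegral.integral_sub ((hgn _ _).add intervalIntegrable_const)
        ((hb _ _).const_mul _),
      intervalIntegral.integral_add (hgn _ _) intervalIntegrable_const,
      intervalIntegral.integral_neg, intervalIntegral.integral_const_mul,
      intervalIntegral.integral_const]
    have : ∫ s in (0 : ℝ)..t, a s * g (IccExtend hT.le u s) = ∫ s in (0 : ℝ)..t, a s * g (U s) := by
      refine intervalIntegral.integral_congr fun s hs => ?_
      rw [uIcc_of_le ht.1] at hs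
      simp only [hUe s ⟨hs.1, hs.2.trans ht.2⟩]
    rw [this, smul_eq_mul]
    ring

end PeriodicExtension

section AprioriBounds

lemma sub_le_mul_of_hasDerivAt_le {f f' : ℝ → ℝ} (hf : ∀ t, HasDerivAt f (f' t) t) {x y c : ℝ}
    (hxy : x ≤ y) (hc : ∀ t ∈ Ioo x y, f' t ≤ c) : f y - f x ≤ c * (y - x) := by
  rcases hxy.eq_or_lt with rfl | hlt
  · simp
  · obtain ⟨t, ht, hft⟩ := exists_hasDerivAt_eq_slope f f' hlt
      (fun t _ => (hf t).continuousAt.continuousWithinAt) fun t _ => hf t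
    have := hc t ht
    rwa [hft, div_le_iff₀ (sub_pos.2 hlt)] at this

lemma mul_le_sub_of_le_hasDerivAt {f f' : ℝ → ℝ} (hf : ∀ t, HasDerivAt f (f' t) t) {x y c : ℝ}
    (hxy : x ≤ y) (hc : ∀ t ∈ Ioo x y, c ≤ f' t) : c * (y - x) ≤ f y - f x := by
  have := sub_le_mul_of_hasDerivAt_le (fun t => (hf t).neg) hxy (c := -c)
    fun t ht => neg_le_neg (hc t ht)
  simp only [Pi.neg_apply] at this
  linarith

/-- A function `u` with `u' = h(t, v)` that stays nonnegative cannot start too high when `v`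
decreases from a nonpositive value at a rate controlled by `g(u)`. -/
lemma le_of_forced_descent {h : ℝ → ℝ → ℝ} (hh0 : ∀ t, h t 0 = 0) (hh1 : ∀ t, Monotone (h t))
    {g u v : ℝ → ℝ} (hu : ∀ t, HasDerivAt u (h t (v t)) t) {t₀ δ : ℝ} (hδ : 0 < δ)
    (hu0 : 0 ≤ u (t₀ + 2 * δ)) (hv0 : v t₀ ≤ 0) (hv : AntitoneOn v (Icc t₀ (t₀ + 2 * δ)))
    (hgu : ContinuousOn (fun t => g (u t)) (Icc t₀ (t₀ + δ))) (hgu0 : ∀ t, 0 ≤ g (u t)) {κ : ℝ}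
    (hvδ : ∀ c, 0 ≤ c → (∀ t ∈ Icc t₀ (t₀ + δ), c ≤ g (u t)) → v (t₀ + δ) ≤ -κ * c)
    {s₀ : ℝ} (hs₀ : 0 < s₀) (h₁ : ∀ s, s₀ ≤ s → ∀ t, h t (-κ * g s) ≤ -(2 / δ) * s) {V₀ H₀ : ℝ}
    (h₂ : ∀ t, h t (-V₀) ≤ -(2 / δ) * s₀) (h₃ : ∀ t, ∀ x ∈ Icc (-V₀) 0, -H₀ ≤ h t x) :
    u t₀ ≤ s₀ + δ * H₀ := by
  have hm : t₀ ∈ Icc t₀ (t₀ + 2 * δ) := ⟨le_rfl, by linarith⟩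
  have hmδ : t₀ + δ ∈ Icc t₀ (t₀ + 2 * δ) := ⟨by linarith, by linarith⟩
  have hdrop : ∀ c, v (t₀ + δ) ≤ c → ∀ d, (∀ t, h t c ≤ -(2 / δ) * d) →
      u (t₀ + 2 * δ) ≤ u (t₀ + δ) - 2 * d := fun c hc d hd => by
    have := sub_le_mul_of_hasDerivAt_le hu (x := t₀ + δ) (y := t₀ + 2 * δ) (by linarith)
      fun t ht => (hh1 t ((hv hmδ ⟨by linarith [ht.1], ht.2.le⟩ ht.1.le).trans hc)).trans (hd t)
    have e : -(2 / δ) * d * (t₀ + 2 * δ - (t₀ + δ)) = -2 * d := by field_simp; ring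
    linarith
  have hanti : ∀ t ∈ Icc t₀ (t₀ + δ), u (t₀ + δ) ≤ u t := fun t ht => by
    have := sub_le_mul_of_hasDerivAt_le hu ht.2 (c := 0) fun s hs => by
      rw [← hh0 s]
      exact hh1 s ((hv hm ⟨by linarith [ht.1, hs.1], by linarith [hs.2]⟩
        (by linarith [ht.1, hs.1])).trans hv0)
    linarith
  have hw : u (t₀ + δ) < s₀ := by
    by_contra! hw
    obtain ⟨t', ht', hmin⟩ := isCompact_Icc.exists_isMinOn (nonempty_Icc.2 (by linarith)) hgu
    have h4 := hanti t' ht'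
    have := hdrop _ (hvδ (g (u t')) (hgu0 t') fun t ht => hmin ht) _ (h₁ _ (hw.trans h4))
    linarith
  have hV : -V₀ < v (t₀ + δ) := by
    by_contra! hV
    have := hdrop _ hV s₀ h₂
    linarith
  have := mul_le_sub_of_le_hasDerivAt hu (x := t₀) (y := t₀ + δ) (c := -H₀) (by linarith)
    fun t ht => h₃ t _ ⟨hV.le.trans (hv ⟨ht.1.le, by linarith [ht.2]⟩ hmδ ht.2.le),
      (hv hm ⟨ht.1.le, by linarith [ht.2]⟩ ht.1.le).trans hv0⟩
  linarith [show -H₀ * (t₀ + δ - t₀) = -(δ * H₀) by ring]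

lemma exists_small_slope {h : ℝ → ℝ → ℝ} (hh1 : ∀ t, Monotone (h t)) {g : ℝ → ℝ}
    (hzero : ∀ K : ℝ, TendstoUniformly (fun s t => h t (K * g s) / s)
      (fun _ => 0) (nhdsWithin 0 (Ioi 0))) (K : ℝ) {ε : ℝ} (hε : 0 < ε) :
    ∃ r > 0, ∀ s, 0 < s → s < r → ∀ t x, |x| ≤ K * g s → |h t x| ≤ ε * s := by
  have h1 := (Metric.tendstoUniformly_iff.1 (hzero K) ε hε).and
    (Metric.tendstoUniformly_iff.1 (hzero (-K)) ε hε)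
  obtain ⟨r, hr, hrs⟩ := mem_nhdsGT_iff_exists_Ioo_subset.1 h1
  refine ⟨r, hr, fun s hs hsr t x hx => ?_⟩
  have h2 := hrs ⟨hs, hsr⟩
  have h3 := h2.1 t
  have h4 := h2.2 t
  rw [dist_comm, Real.dist_eq, sub_zero, abs_div, abs_of_pos hs, div_lt_iff₀ hs] at h3 h4
  rw [abs_le] at hx ⊢
  rw [neg_mul] at h4
  exact ⟨(abs_lt.1 h4).1.le.trans (hh1 t hx.1), (hh1 t hx.2).trans (abs_lt.1 h3).2.le⟩

lemma abs_integral_mul_le_of_periodic {T : ℝ} {a f : ℝ → ℝ}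
    (ha : ∀ x y, IntervalIntegrable a volume x y) (haper : Function.Periodic a T) {x y C : ℝ}
    (hxy : x ≤ y) (hyT : y ≤ x + T) (hC : 0 ≤ C) (hf : ∀ t ∈ Ioc x y, |f t| ≤ C) :
    |∫ t in x..y, a t * f t| ≤ C * ∫ t in (0 : ℝ)..T, ‖a t‖ := by
  have h1 : |∫ t in x..y, a t * f t| ≤ ∫ t in x..y, C * ‖a t‖ := by
    refine intervalIntegral.norm_integral_le_of_norm_le (f := fun t => a t * f t) hxy
      (ae_of_all _ fun t ht => ?_)
      ((ha x y).norm.const_mul C)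
    rw [norm_mul, mul_comm]
    exact mul_le_mul_of_nonneg_right (hf t ht) (norm_nonneg _)
  refine h1.trans ?_
  rw [intervalIntegral.integral_const_mul]
  refine mul_le_mul_of_nonneg_left ?_ hC
  have hper : Function.Periodic (fun t => ‖a t‖) T := fun t => by simp only [haper t]
  have h2 := hper.intervalIntegral_add_eq x 0
  rw [zero_add] at h2
  rw [← h2]
  exact intervalIntegral.integral_mono_interval le_rfl hxy hyT
    (ae_of_all _ fun _ => norm_nonneg _) (ha _ _).norm

lemma exists_pos_forall_le_of_pos {g : ℝ → ℝ} (hgc : ContinuousOn g (Ici 0)) (hg0 : g 0 = 0)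
    (hgpos : ∀ s, 0 < s → 0 < g s) {m : ℝ} (hm : 0 < m) :
    ∃ s, 0 < s ∧ s ≤ m ∧ 0 < g s ∧ ∀ x ∈ Icc 0 m, |g x| ≤ g s := by
  obtain ⟨s, hs, hmax⟩ := isCompact_Icc.exists_isMaxOn (nonempty_Icc.2 hm.le)
    (hgc.mono fun x (hx : x ∈ Icc 0 m) => hx.1)
  have h1 : 0 < g s := (hgpos m hm).trans_le (hmax ⟨hm.le, le_rfl⟩)
  have h2 : 0 < s := hs.1.lt_of_ne fun e => by rw [← e, hg0] at h1; exact h1.false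
  refine ⟨s, h2, hs.2, h1, fun x hx => ?_⟩
  rw [abs_of_nonneg]
  · exact hmax hx
  · rcases hx.1.eq_or_lt with e | h
    · rw [← e, hg0]
    · exact (hgpos x h).le

lemma eq_zero_of_forall_le {h : ℝ → ℝ → ℝ} (hh0 : ∀ t, h t 0 = 0) (hh1 : ∀ t, StrictMono (h t))
    {u v : ℝ → ℝ} (hu : ∀ t, HasDerivAt u (h t (v t)) t) {z : ℝ} (hz : ∀ t, u t ≤ u z) :
    v z = 0 := by
  have h1 : IsLocalMax u z := Eventually.of_forall hz
  have := h1.hasDerivAt_eq_zero (hu z)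
  exact (hh1 z).injective (this.trans (hh0 z).symm)

lemma eq_zero_of_forall_ge {h : ℝ → ℝ → ℝ} (hh0 : ∀ t, h t 0 = 0) (hh1 : ∀ t, StrictMono (h t))
    {u v : ℝ → ℝ} (hu : ∀ t, HasDerivAt u (h t (v t)) t) {z : ℝ} (hz : ∀ t, u z ≤ u t) :
    v z = 0 := by
  have h1 : IsLocalMin u z := Eventually.of_forall hz
  have := h1.hasDerivAt_eq_zero (hu z)
  exact (hh1 z).injective (this.trans (hh0 z).symm)

/-- Nonnegativity: wherever `u < 0`, `v` cannot increase. -/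
lemma nonneg_of_antitone_of_neg {T : ℝ} (hT : 0 < T) {h : ℝ → ℝ → ℝ} (hh0 : ∀ t, h t 0 = 0)
    (hh1 : ∀ t, StrictMono (h t)) {u v : ℝ → ℝ} (huper : Function.Periodic u T)
    (hu : ∀ t, HasDerivAt u (h t (v t)) t)
    (hv : ∀ x y, x ≤ y → (∀ t ∈ Icc x y, u t < 0) → v y ≤ v x) {z : ℝ} (hz : 0 ≤ u z) (t : ℝ) :
    0 ≤ u t := by
  by_contra! ht
  have hc : Continuous u := continuous_iff_continuousAt.2 fun t => (hu t).continuousAt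
  have hcl : IsClosed {x | 0 ≤ u x} := isClosed_le continuous_const hc
  obtain ⟨z₁, hz₁, e₁⟩ := huper.exists_mem_Ico hT z t
  have hne₁ : ({x | 0 ≤ u x} ∩ Ici t).Nonempty := ⟨z₁, hz.trans_eq e₁, hz₁.1⟩
  obtain ⟨z₂, hz₂, e₂⟩ := huper.exists_mem_Ico hT z (t - T)
  have hne₂ : ({x | 0 ≤ u x} ∩ Iic t).Nonempty := ⟨z₂, hz.trans_eq e₂, by
    have := hz₂.2; rw [mem_Iic]; linarith⟩
  have hb₁ : BddBelow ({x | 0 ≤ u x} ∩ Ici t) := ⟨t, fun x hx => hx.2⟩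
  have hb₂ : BddAbove ({x | 0 ≤ u x} ∩ Iic t) := ⟨t, fun x hx => hx.2⟩
  obtain ⟨hs, hts⟩ := (hcl.inter isClosed_Ici).csInf_mem hne₁ hb₁
  obtain ⟨hs', hts'⟩ := (hcl.inter isClosed_Iic).csSup_mem hne₂ hb₂
  set s := sInf ({x | 0 ≤ u x} ∩ Ici t)
  set s' := sSup ({x | 0 ≤ u x} ∩ Iic t)
  simp only [mem_ofPred_eq, mem_Ici, mem_Iic] at hs hs' hts hts'
  have hts : t < s := hts.lt_of_ne fun e => by rw [e] at ht; exact ht.not_ge hs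
  have hts' : s' < t := hts'.lt_of_ne fun e => by rw [← e] at ht; exact ht.not_ge hs'
  have hneg : ∀ x ∈ Ioo s' s, u x < 0 := fun x hx => by
    by_contra! hx0
    rcases le_total x t with h1 | h1
    · exact hx.1.not_ge (le_csSup hb₂ ⟨hx0, h1⟩)
    · exact hx.2.not_ge (csInf_le hb₁ ⟨hx0, h1⟩)
  obtain ⟨y, hy, hye⟩ := exists_hasDerivAt_eq_slope u _ hts hc.continuousOn fun t _ => hu t
  have hvy : 0 < v y := by
    rw [← (hh1 y).lt_iff_lt, hh0, hye]
    exact div_pos (by linarith) (by linarith)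
  obtain ⟨x, hx, hxe⟩ := exists_hasDerivAt_eq_slope u _ hts' hc.continuousOn fun t _ => hu t
  have hvx : v y ≤ v x := hv x y (by linarith [hx.2, hy.1]) fun w hw =>
    hneg w ⟨hx.1.trans_le hw.1, hw.2.trans_lt hy.2⟩
  have hpos : 0 < h x (v x) := by
    rw [← hh0 x]
    exact hh1 x (hvy.trans_le hvx)
  rw [hxe, div_pos_iff_of_pos_right (by linarith)] at hpos
  linarith

/-- Strict positivity of nonnegative periodic solutions of `u' = h(t, v)`, `v' = -a(t) g(u)`. -/
lemma pos_of_nonneg {T : ℝ} (hT : 0 < T) {h : ℝ → ℝ → ℝ} (hh0 : ∀ t, h t 0 = 0)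
    (hh1 : ∀ t, StrictMono (h t)) {a g : ℝ → ℝ} (ha : ∀ x y, IntervalIntegrable a volume x y)
    (haper : Function.Periodic a T) (hgc : ContinuousOn g (Ici 0)) (hg0 : g 0 = 0)
    (hgpos : ∀ s, 0 < s → 0 < g s)
    (hzero : ∀ K : ℝ, TendstoUniformly (fun s t => h t (K * g s) / s)
      (fun _ => 0) (nhdsWithin 0 (Ioi 0))) {u v : ℝ → ℝ} (huper : Function.Periodic u T)
    (hu : ∀ t, HasDerivAt u (h t (v t)) t)
    (hv : ∀ x y, v y - v x = ∫ s in x..y, -(a s * g (u s))) (hu0 : ∀ t, 0 ≤ u t) {z : ℝ}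
    (hz : 0 < u z) (t : ℝ) : 0 < u t := by
  by_contra! ht
  have ht : u t = 0 := ht.antisymm (hu0 t)
  have hvt : v t = 0 := eq_zero_of_forall_ge hh0 hh1 hu fun s => ht.trans_le (hu0 s)
  have hc : Continuous u := continuous_iff_continuousAt.2 fun t => (hu t).continuousAt
  obtain ⟨r, hr, hrs⟩ := exists_small_slope (fun t => (hh1 t).monotone) hzero
    (∫ t in (0 : ℝ)..T, ‖a t‖) (ε := 1 / (2 * T)) (by positivity)
  obtain ⟨y, hy0, hy⟩ := exists_between (lt_min hr hz)
  rw [lt_min_iff] at hy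
  obtain ⟨z₁, hz₁, e₁⟩ := huper.exists_mem_Ico hT z t
  have hb : BddBelow ({x | y ≤ u x} ∩ Ici t) := ⟨t, fun x hx => hx.2⟩
  have hmem : z₁ ∈ {x | y ≤ u x} ∩ Ici t := ⟨hy.2.le.trans_eq e₁, hz₁.1⟩
  obtain ⟨hs, hts⟩ := ((isClosed_le continuous_const hc).inter isClosed_Ici).csInf_mem ⟨_, hmem⟩ hb
  have hsT := (csInf_le hb hmem).trans hz₁.2.le
  set s := sInf ({x | y ≤ u x} ∩ Ici t)
  simp only [mem_ofPred_eq, mem_Ici] at hs hts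
  obtain ⟨s₀, hs₀, hs₀y, hgs₀, hmax⟩ := exists_pos_forall_le_of_pos hgc hg0 hgpos hy0
  have hvx : ∀ x ∈ Ioo t s, |v x| ≤ (∫ t in (0 : ℝ)..T, ‖a t‖) * g s₀ := fun x hx => by
    have h1 := hv t x
    rw [hvt, sub_zero, intervalIntegral.integral_neg] at h1
    rw [h1, abs_neg, mul_comm]
    refine abs_integral_mul_le_of_periodic ha haper hx.1.le (by linarith [hx.2]) hgs₀.le
      fun w hw => hmax _ ⟨hu0 w, ?_⟩
    by_contra! hyw
    exact (hw.2.trans_lt hx.2).not_ge (csInf_le hb ⟨hyw.le, hw.1.le⟩)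
  have := sub_le_mul_of_hasDerivAt_le hu hts fun x hx =>
    (le_abs_self _).trans (hrs s₀ hs₀ (hs₀y.trans_lt hy.1) x _ (hvx x hx))
  have h2 : 1 / (2 * T) * s₀ * (s - t) ≤ 1 / (2 * T) * y * T :=
    mul_le_mul (by gcongr) (by linarith) (by linarith) (by positivity)
  have h3 : 1 / (2 * T) * y * T = y / 2 := by field_simp
  linarith

/-- There are no periodic solutions of `u' = h(t, v)`, `v' = -a(t) g(u⁺) + c`, `c > 0`, with a
small positive maximum. -/
lemma exists_lower_bound {T : ℝ} (hT : 0 < T) {h : ℝ → ℝ → ℝ} (hh0 : ∀ t, h t 0 = 0)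
    (hh1 : ∀ t, StrictMono (h t)) {a g : ℝ → ℝ} (ha : ∀ x y, IntervalIntegrable a volume x y)
    (haper : Function.Periodic a T) (haneg : (∫ t in (0 : ℝ)..T, a t) < 0)
    (hgc : ContinuousOn g (Ici 0)) (hg0 : g 0 = 0)
    (hgpos : ∀ s, 0 < s → 0 < g s) (hreg : RegOscZero g)
    (hzero : ∀ K : ℝ, TendstoUniformly (fun s t => h t (K * g s) / s)
      (fun _ => 0) (nhdsWithin 0 (Ioi 0))) :
    ∃ r > 0, ∀ (u v : ℝ → ℝ) (c z : ℝ), Function.Periodic u T → Function.Periodic v T →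
      (∀ t, HasDerivAt u (h t (v t)) t) →
      (∀ x y, v y - v x = ∫ s in x..y, (-(a s * g (max 0 (u s))) + c)) → (∀ t, u t ≤ u z) →
      0 < u z → 0 < c → r ≤ u z := by
  set A := ∫ t in (0 : ℝ)..T, ‖a t‖
  set I := ∫ t in (0 : ℝ)..T, a t
  have hA : 0 ≤ A := intervalIntegral.integral_nonneg hT.le fun _ _ => norm_nonneg _
  have hη : 0 < -I / (A + 1) := div_pos (by linarith) (by linarith)
  have h1 := Metric.tendsto_nhds.1 hreg _ hη
  obtain ⟨W, hW, S, hS, hWS⟩ := mem_prod_iff.1 h1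
  obtain ⟨θ, hθ, hθW⟩ := Metric.mem_nhds_iff.1 hW
  obtain ⟨r₁, hr₁, hr₁S⟩ := mem_nhdsGT_iff_exists_Ioo_subset.1 hS
  obtain ⟨ε, hε, hεT⟩ := exists_between (show 0 < min θ 1 / T by positivity)
  rw [lt_div_iff₀ hT, lt_min_iff] at hεT
  obtain ⟨r₂, hr₂, hr₂s⟩ := exists_small_slope (fun t => (hh1 t).monotone) hzero (2 * A) hε
  refine ⟨min r₁ r₂, lt_min hr₁ hr₂, fun u v c z huper hvper hu hv hz hz0 hc => ?_⟩
  by_contra! hlt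
  rw [lt_min_iff] at hlt
  have hvz : v z = 0 := eq_zero_of_forall_le hh0 hh1 hu hz
  have hcu : Continuous u := continuous_iff_continuousAt.2 fun t => (hu t).continuousAt
  have hgu : Continuous fun t => g (max 0 (u t)) :=
    hgc.comp_continuous (continuous_const.max hcu) fun t => mem_Ici.2 (le_max_left _ _)
  have hi : ∀ x y, IntervalIntegrable (fun s => a s * g (max 0 (u s))) volume x y :=
    fun x y => (ha x y).mul_continuousOn hgu.continuousOn
  have hin : ∀ x y, IntervalIntegrable (fun s => -(a s * g (max 0 (u s)))) volume x y :=
    fun x y => (hi x y).neg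
  have hv' : ∀ x y, v y - v x = -(∫ s in x..y, a s * g (max 0 (u s))) + c * (y - x) :=
    fun x y => by
      rw [hv, intervalIntegral.integral_add (hin x y) intervalIntegrable_const,
        intervalIntegral.integral_neg, intervalIntegral.integral_const, smul_eq_mul, mul_comm c]
  have hcT : ∫ s in (0 : ℝ)..T, a s * g (max 0 (u s)) = c * T := by
    have := hv' 0 T
    have h2 := hvper 0
    rw [zero_add] at h2
    rw [h2] at this
    linarith
  obtain ⟨s₀, hs₀, hs₀z, hgs₀, hmax⟩ := exists_pos_forall_le_of_pos hgc hg0 hgpos hz0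
  have hgu_le : ∀ t, |g (max 0 (u t))| ≤ g s₀ := fun t =>
    hmax _ ⟨le_max_left _ _, max_le hz0.le (hz t)⟩
  have hcA : c * T ≤ A * g s₀ := by
    rw [← hcT, mul_comm]
    exact (le_abs_self _).trans (abs_integral_mul_le_of_periodic ha haper hT.le (by simp) hgs₀.le
      fun t _ => hgu_le t)
  have hvt : ∀ t ∈ Icc z (z + T), |v t| ≤ 2 * A * g s₀ := fun t ht => by
    have h2 := hv' z t
    rw [hvz, sub_zero] at h2
    have h3 := abs_integral_mul_le_of_periodic ha haper ht.1 ht.2 hgs₀.le fun t _ => hgu_le t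
    have h4 : c * (t - z) ≤ c * T := by
      have := ht.2
      gcongr
      linarith
    have h5 : 0 ≤ c * (t - z) := mul_nonneg hc.le (by linarith [ht.1])
    rw [h2]
    refine (abs_add_le _ _).trans ?_
    rw [abs_neg, abs_of_nonneg h5]
    linarith
  have hulow : ∀ t, (1 - ε * T) * u z ≤ u t := fun t => by
    obtain ⟨y, hy, e⟩ := huper.exists_mem_Ico hT t z
    rw [e]
    have h2 := mul_le_sub_of_le_hasDerivAt hu (x := z) (y := y) (c := -(ε * s₀)) hy.1
      fun t ht => (abs_le.1 (hr₂s s₀ hs₀ (hs₀z.trans_lt hlt.2) t (v t)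
        (hvt t ⟨ht.1.le, ht.2.le.trans hy.2.le⟩))).1
    have h3 : ε * s₀ * (y - z) ≤ ε * u z * T := by
      have := hy.2
      have := hy.1
      refine mul_le_mul (by gcongr) (by linarith) (by linarith) (by positivity)
    linarith
  have hupos : ∀ t, 0 < u t := fun t => (mul_pos (by linarith) hz0).trans_le (hulow t)
  have hgz := hgpos _ hz0
  have hosc : ∀ t, |g (max 0 (u t)) - g (u z)| ≤ -I / (A + 1) * g (u z) := fun t => by
    have h2 : (u t / u z, u z) ∈ W ×ˢ S := by
      refine ⟨hθW ?_, hr₁S ⟨hz0, hlt.1⟩⟩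
      rw [Metric.mem_ball, Real.dist_eq, abs_sub_lt_iff]
      have h3 : u t / u z ≤ 1 := (div_le_one hz0).2 (hz t)
      have h4 : 1 - ε * T ≤ u t / u z := (le_div_iff₀ hz0).2 (hulow t)
      exact ⟨by linarith, by linarith⟩
    have h3 := hWS h2
    simp only [mem_ofPred_eq, div_mul_cancel₀ _ hz0.ne'] at h3
    rw [Real.dist_eq, div_sub_one hgz.ne', abs_div, abs_of_pos hgz, div_lt_iff₀ hgz] at h3
    rw [max_eq_right (hupos t).le]
    exact h3.le
  have h2 := abs_integral_mul_le_of_periodic ha haper hT.le (by simp)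
    (mul_nonneg hη.le hgz.le) fun t _ => hosc t
  have h3 : ∫ t in (0 : ℝ)..T, a t * (g (max 0 (u t)) - g (u z)) = c * T - I * g (u z) := by
    simp only [mul_sub]
    rw [intervalIntegral.integral_sub (hi _ _) ((ha _ _).mul_const _), hcT,
      intervalIntegral.integral_mul_const]
  rw [h3] at h2
  have h4 : -I / (A + 1) * g (u z) * A ≤ -I * g (u z) := by
    rw [mul_right_comm]
    refine mul_le_mul_of_nonneg_right ?_ hgz.le
    rw [div_mul_eq_mul_div, div_le_iff₀ (by linarith)]
    nlinarith
  have := (le_abs_self _).trans h2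
  have : 0 < c * T := by positivity
  linarith

end AprioriBounds

section UpperBound

lemma exists_le_integral_of_pos {T : ℝ} {a : ℝ → ℝ} (ha : ∀ x y, IntervalIntegrable a volume x y)
    {N : ℕ} {σ τ : Fin (N + 1) → ℝ} (hstar : SignChanging T a N σ τ) {δ : ℝ} (hδ : 0 < δ) :
    ∃ κ > 0, ∀ n t, σ n ≤ t → t + δ ≤ τ n → κ ≤ ∫ s in t..(t + δ), a s := by
  have hcont : Continuous fun t => ∫ s in t..(t + δ), a s := by
    have h1 := intervalIntegral.continuous_primitive ha 0
    have h2 : (fun t => ∫ s in t..(t + δ), a s) =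
        fun t => (∫ s in (0 : ℝ)..(t + δ), a s) - ∫ s in (0 : ℝ)..t, a s := by
      funext t
      rw [intervalIntegral.integral_interval_sub_left (ha _ _) (ha _ _)]
    rw [h2]
    exact (h1.comp (continuous_id.add continuous_const)).sub h1
  have hn : ∀ n, ∃ κ > 0, ∀ t, σ n ≤ t → t + δ ≤ τ n → κ ≤ ∫ s in t..(t + δ), a s := fun n => by
    rcases (Icc (σ n) (τ n - δ)).eq_empty_or_nonempty with he | hne
    · refine ⟨1, one_pos, fun t h1 h2 => ?_⟩
      have : t ∈ Icc (σ n) (τ n - δ) := ⟨h1, by linarith⟩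
      rw [he] at this
      exact this.elim
    · obtain ⟨t, ht, hmin⟩ := isCompact_Icc.exists_isMinOn hne hcont.continuousOn
      refine ⟨∫ s in t..(t + δ), a s, ?_, fun t' h1 h2 => hmin ⟨h1, by linarith⟩⟩
      have hpos : ∀ᵐ s, s ∈ Ioc t (t + δ) → 0 < a s := by
        filter_upwards [hstar.2.2.2.1 n] with s hs hst
        exact hs ⟨ht.1.trans hst.1.le, by linarith [hst.2, ht.2]⟩
      have hlt : t < t + δ := by linarith
      refine (intervalIntegral.integral_pos_iff_support_of_nonneg_ae' ?_ (ha _ _)).2 ⟨hlt, ?_⟩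
      · rw [uIoc_of_le hlt.le, EventuallyLE, ae_restrict_iff' measurableSet_Ioc]
        filter_upwards [hpos] with s hs hst
        exact (hs hst).le
      · have hvol : 0 < volume (Ioc t (t + δ)) := by simpa using hδ
        refine hvol.trans_le (measure_mono_ae ?_)
        filter_upwards [hpos] with s hs hst
        exact ⟨(hs hst).ne', hst⟩
  choose κ hκ hκ' using hn
  obtain ⟨n₀, hn₀⟩ := Finite.exists_min κ
  exact ⟨κ n₀, hκ n₀, fun n t h1 h2 => (hn₀ n).trans (hκ' n t h1 h2)⟩

lemma exists_isMax_mem_Icc {T : ℝ} (hT : 0 < T) {h : ℝ → ℝ → ℝ} (hh0 : ∀ t, h t 0 = 0)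
    (hh1 : ∀ t, StrictMono (h t)) {N : ℕ} {a : ℝ → ℝ} {σ τ : Fin (N + 1) → ℝ}
    (hstar : SignChanging T a N σ τ)
    {u v : ℝ → ℝ} (huper : Function.Periodic u T) (hu : ∀ t, HasDerivAt u (h t (v t)) t)
    (hv : ∀ x y, x ≤ y → (∀ᵐ t, t ∈ Ioc x y → a t ≤ 0) → v x ≤ v y) {z : ℝ}
    (hz : ∀ t, u t ≤ u z) :
    ∃ n, ∃ y ∈ Icc (σ n) (τ n), u y = u z := by
  obtain ⟨hστ, hlt, hτ, -, hneg⟩ := hstar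
  obtain ⟨y, hy, hye⟩ := huper.exists_mem_Ico hT z (σ 0)
  by_cases hmem : ∃ n, y ∈ Icc (σ n) (τ n)
  · obtain ⟨n, hn⟩ := hmem
    exact ⟨n, y, hn, hye.symm⟩
  push Not at hmem
  have h0 : τ 0 < y := by
    by_contra! h0
    exact hmem 0 ⟨hy.1, h0⟩
  obtain ⟨n, hn, hmax⟩ := (Finset.univ.filter fun n => τ n < y).exists_max_image id
    ⟨0, by simpa using h0⟩
  simp only [Finset.mem_filter, Finset.mem_univ, true_and, id] at hn hmax
  have hvy : v y = 0 := eq_zero_of_forall_le hh0 hh1 hu fun t => (hz t).trans_eq hye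
  have hnot : ∀ t ∈ Ioc (τ n) y, ∀ k, t ∉ Icc (σ k) (τ k) := fun t ht k hk => by
    rcases lt_trichotomy k n with h1 | rfl | h1
    · have := hlt k n h1
      linarith [hk.2, ht.1, hστ n]
    · exact ht.1.not_ge hk.2
    · refine hmem k ⟨hk.1.trans ht.2, ?_⟩
      by_contra! h2
      exact h1.not_ge (hmax k h2)
  have hσ0 : σ 0 ≤ τ n := by
    rcases (Fin.zero_le n).eq_or_lt with h1 | h1
    · rw [← h1]; exact (hστ 0).le
    · linarith [hlt 0 n h1, hστ 0, hστ n]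
  have hvt : ∀ t ∈ Icc (τ n) y, v t ≤ 0 := fun t ht => by
    rw [← hvy]
    refine hv t y ht.2 ?_
    filter_upwards [hneg] with s hs hst
    refine hs ⟨⟨by linarith [ht.1, hst.1], hst.2.trans_lt hy.2⟩, ?_⟩
    rw [mem_iUnion, not_exists]
    exact hnot s ⟨ht.1.trans_lt hst.1, hst.2⟩
  have := sub_le_mul_of_hasDerivAt_le hu hn.le (c := 0) fun t ht => by
    rw [← hh0 t]
    exact (hh1 t).monotone (hvt t ⟨ht.1.le, ht.2.le⟩)
  exact ⟨n, τ n, ⟨(hστ n).le, le_rfl⟩, le_antisymm (hz _) (by linarith)⟩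

/-- A priori upper bound for nonnegative periodic solutions of `u' = h(t, v)`,
`v' = -a(t) g(u) - c a⁺(t)`, uniformly in `c ≥ 0`. -/
lemma exists_upper_bound {T : ℝ} (hT : 0 < T) {h : ℝ → ℝ → ℝ}
    (hhc : Continuous (Function.uncurry h)) (hhper : ∀ t s, h (t + T) s = h t s)
    (hh0 : ∀ t, h t 0 = 0) (hh1 : ∀ t, StrictMono (h t)) {a g : ℝ → ℝ}
    (ha : ∀ x y, IntervalIntegrable a volume x y) {N : ℕ} {σ τ : Fin (N + 1) → ℝ}
    (hstar : SignChanging T a N σ τ) (hgc : ContinuousOn g (Ici 0)) (hg0 : g 0 = 0)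
    (hgpos : ∀ s, 0 < s → 0 < g s)
    (hinf : ∀ K : ℝ, K ≠ 0 → ∀ M : ℝ, ∀ᶠ s in Filter.atTop,
      ∀ t : ℝ, M ≤ Real.sign K * (h t (K * g s) / s)) :
    ∃ R, ∀ (u v : ℝ → ℝ) (c z : ℝ), 0 ≤ c → Function.Periodic u T →
      (∀ t, HasDerivAt u (h t (v t)) t) →
      (∀ x y, v y - v x = ∫ s in x..y, (-(a s * g (u s)) - c * max (a s) 0)) → (∀ t, 0 ≤ u t) →
      (∀ t, u t ≤ u z) → u z ≤ R := by
  have hg0' : ∀ s, 0 ≤ s → 0 ≤ g s := fun s hs => by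
    rcases hs.eq_or_lt with e | h
    · rw [← e, hg0]
    · exact (hgpos s h).le
  have hinf' : ∀ K, 0 < K → ∀ M, ∀ᶠ s in atTop, ∀ t,
      M * s ≤ h t (K * g s) ∧ h t (-K * g s) ≤ -M * s := fun K hK M => by
    filter_upwards [hinf K hK.ne' M, hinf (-K) (neg_ne_zero.2 hK.ne') M, eventually_gt_atTop 0]
      with s h1 h2 hs t
    have h1 := h1 t
    have h2 := h2 t
    rw [Real.sign_of_pos hK, one_mul, le_div_iff₀ hs] at h1
    rw [Real.sign_of_neg (neg_neg_of_pos hK), neg_one_mul, ← neg_div, le_div_iff₀ hs] at h2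
    exact ⟨h1, by linarith⟩
  obtain ⟨n₀, hn₀⟩ := Finite.exists_min fun n => τ n - σ n
  set δ := (τ n₀ - σ n₀) / 4
  have hδ : 0 < δ := by
    have := hstar.1 n₀
    simp only [δ]; linarith
  have hδn : ∀ n, σ n + 4 * δ ≤ τ n := fun n => by
    have := hn₀ n
    simp only [δ]; linarith
  obtain ⟨κ, hκ, hκa⟩ := exists_le_integral_of_pos ha hstar hδ
  obtain ⟨s₀, hs₀⟩ := eventually_atTop.1 ((hinf' κ hκ (2 / δ)).and (eventually_gt_atTop 0))
  have hs₀pos : 0 < s₀ := (hs₀ s₀ le_rfl).2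
  obtain ⟨s₁, hs₁, hs₁pos⟩ := ((hinf' 1 one_pos (2 / δ * s₀)).and (eventually_ge_atTop 1)).exists
  simp only [one_mul, neg_mul] at hs₁
  set V₀ := g s₁
  have hV₀ : ∀ t, 2 / δ * s₀ ≤ h t V₀ ∧ h t (-V₀) ≤ -(2 / δ * s₀) := fun t => by
    have h1 : 2 / δ * s₀ ≤ 2 / δ * s₀ * s₁ := le_mul_of_one_le_right (by positivity) hs₁pos
    exact ⟨h1.trans (hs₁ t).1, (hs₁ t).2.trans (neg_le_neg h1)⟩
  obtain ⟨H₀, hH₀⟩ := ((isCompact_Icc (a := (0 : ℝ)) (b := T)).prod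
    (isCompact_Icc (a := -V₀) (b := V₀))).exists_bound_of_continuousOn hhc.continuousOn
  have hH₀ : ∀ t, ∀ x ∈ Icc (-V₀) V₀, |h t x| ≤ H₀ := fun t x hx => by
    have hp : Function.Periodic (fun t => h t x) T := fun t => hhper t x
    obtain ⟨y, hy, e⟩ := hp.exists_mem_Ico₀ hT t
    rw [e]
    exact hH₀ (y, x) ⟨⟨hy.1, hy.2.le⟩, hx⟩
  have hV₀0 : 0 ≤ V₀ := hg0' _ (by linarith)
  refine ⟨s₀ + δ * H₀, fun u v c z hc huper hu hv hu0 hz => ?_⟩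
  have hcu : Continuous u := continuous_iff_continuousAt.2 fun t => (hu t).continuousAt
  have hgu : Continuous fun t => g (u t) := hgc.comp_continuous hcu hu0
  have hi : ∀ x y, IntervalIntegrable (fun s => a s * g (u s)) volume x y :=
    fun x y => (ha x y).mul_continuousOn hgu.continuousOn
  have hia : ∀ x y, IntervalIntegrable (fun s => max (a s) 0) volume x y := fun x y =>
    ⟨(ha x y).1.pos_part, (ha x y).2.pos_part⟩
  have hid : ∀ x y, IntervalIntegrable (fun s => -(a s * g (u s)) - c * max (a s) 0) volume x y :=
    fun x y => (hi x y).neg.sub ((hia x y).const_mul c)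
  obtain ⟨n, y, hy, hye⟩ := exists_isMax_mem_Icc hT hh0 hh1 hstar huper hu (fun x y hxy hneg => by
    rw [← sub_nonneg, hv, intervalIntegral.integral_of_le hxy]
    refine integral_nonneg_of_ae ?_
    rw [EventuallyLE, ae_restrict_iff' measurableSet_Ioc]
    filter_upwards [hneg] with t ht hmem
    have := ht hmem
    rw [max_eq_right this, Pi.zero_apply]
    have := mul_nonneg (neg_nonneg.2 this) (hg0' _ (hu0 t))
    linarith) hz
  rw [← hye]
  have hvy : v y = 0 := eq_zero_of_forall_le hh0 hh1 hu fun t => (hz t).trans_eq hye.symm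
  have hforce : ∀ x y d, x ≤ y → Icc x y ⊆ Icc (σ n) (τ n) →
      (∀ t ∈ Icc x y, d ≤ g (u t)) → v y - v x ≤ -(d * ∫ s in x..y, a s) :=
    fun x y d hxy hsub hd => by
      rw [hv, ← intervalIntegral.integral_const_mul, ← intervalIntegral.integral_neg]
      refine intervalIntegral.integral_mono_ae_restrict hxy (hid x y) ((ha x y).const_mul d).neg ?_
      rw [EventuallyLE, ae_restrict_iff' measurableSet_Icc]
      filter_upwards [hstar.2.2.2.1 n] with t ht hmem
      have h1 := ht (hsub hmem)
      rw [max_eq_left h1.le]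
      have h2 := mul_le_mul_of_nonneg_left (hd t hmem) h1.le
      have h3 := mul_nonneg hc h1.le
      linarith
  have hanti : AntitoneOn v (Icc (σ n) (τ n)) := fun x hx y hy hxy => by
    have := hforce x y 0 hxy (Icc_subset_Icc hx.1 hy.2) fun t _ => hg0' _ (hu0 t)
    linarith
  rcases le_total y (σ n + 2 * δ) with h1 | h1
  · have hsub : Icc y (y + 2 * δ) ⊆ Icc (σ n) (τ n) :=
      Icc_subset_Icc hy.1 (by linarith [hδn n])
    refine le_of_forced_descent hh0 (fun t => (hh1 t).monotone) hu hδ (hu0 _) hvy.le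
      (hanti.mono hsub) hgu.continuousOn (fun t => hg0' _ (hu0 t)) (κ := κ)
      (fun d hd0 hd => ?_) hs₀pos
      (fun s hs t => ((hs₀ s hs).1 t).2) (fun t => ?_)
      (fun t x hx => (abs_le.1 (hH₀ t x ⟨hx.1, hx.2.trans hV₀0⟩)).1)
    · have h2 := hforce y (y + δ) d (by linarith)
        (Icc_subset_Icc hy.1 (by linarith [hδn n])) hd
      have h3 := mul_le_mul_of_nonneg_left (hκa n y hy.1 (by linarith [hδn n])) hd0
      rw [hvy] at h2
      linarith
    · rw [neg_mul]; exact (hV₀ t).2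
  · have := le_of_forced_descent (h := fun t s => -h (-t) (-s)) (u := fun t => u (-t))
      (v := fun t => -v (-t)) (t₀ := -y) (g := g) (by simp [hh0])
      (fun t p q hpq => neg_le_neg ((hh1 _).monotone (neg_le_neg hpq)))
      (fun t => by
        have := (hu (-t)).comp t (hasDerivAt_neg t)
        rw [mul_neg_one] at this
        simp only [neg_neg]
        exact this)
      hδ (hu0 _) (by simp [hvy])
      (fun p hp q hq hpq => neg_le_neg (hanti ⟨by linarith [hq.2], by linarith [hq.1, hy.2]⟩
        ⟨by linarith [hp.2], by linarith [hp.1, hy.2]⟩ (neg_le_neg hpq)))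
      (hgu.comp continuous_neg).continuousOn (fun t => hg0' _ (hu0 (-t))) (κ := κ)
      (fun d hd0 hd => ?_) hs₀pos
      (fun s hs t => by simpa using ((hs₀ s hs).1 (-t)).1)
      (V₀ := V₀) (H₀ := H₀) (fun t => by simpa using (hV₀ (-t)).1)
      (fun t x hx => neg_le_neg (abs_le.1 (hH₀ (-t) (-x)
        ⟨by linarith [hx.2], by linarith [hx.1]⟩)).2)
    · simpa using this
    · have hyδ : y - δ + δ = y := by ring
      have h2 := hforce (y - δ) y d (by linarith)
        (Icc_subset_Icc (by linarith) hy.2) fun t ht => by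
          simpa using hd (-t) ⟨neg_le_neg ht.2, by linarith [ht.1]⟩
      have h3 := mul_le_mul_of_nonneg_left (hκa n (y - δ) (by linarith) (by linarith [hy.2])) hd0
      rw [hyδ] at h3
      rw [hvy] at h2
      rw [show -(-y + δ) = y - δ by ring]
      linarith

end UpperBound

theorem exists_pos_periodicSol {T : ℝ} (hT : 0 < T) {h : ℝ → ℝ → ℝ}
    (hhc : Continuous (Function.uncurry h)) (hhper : ∀ t s, h (t + T) s = h t s)
    (hh0 : ∀ t, h t 0 = 0) (hh1 : ∀ t, StrictMono (h t)) {a g : ℝ → ℝ}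
    (ha : ∀ x y, IntervalIntegrable a volume x y) (haper : Function.Periodic a T)
    (haneg : (∫ t in (0 : ℝ)..T, a t) < 0) {N : ℕ} {σ τ : Fin (N + 1) → ℝ}
    (hstar : SignChanging T a N σ τ) (hgc : ContinuousOn g (Ici 0)) (hg0 : g 0 = 0)
    (hgpos : ∀ s, 0 < s → 0 < g s) (hreg : RegOscZero g)
    (hzero : ∀ K : ℝ, TendstoUniformly (fun s t => h t (K * g s) / s)
      (fun _ => 0) (nhdsWithin 0 (Ioi 0)))
    (hinf : ∀ K : ℝ, K ≠ 0 → ∀ M : ℝ, ∀ᶠ s in Filter.atTop,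
      ∀ t : ℝ, M ≤ Real.sign K * (h t (K * g s) / s)) :
    ∃ u v : ℝ → ℝ, IsPeriodicSol T h (fun t x => -(a t * g x)) u v ∧ ∀ t, 0 < u t := by
  obtain ⟨r, hr, hlower⟩ := exists_lower_bound hT hh0 hh1 ha haper haneg hgc hg0 hgpos hreg hzero
  obtain ⟨R₀, hupper⟩ := exists_upper_bound hT hhc hhper hh0 hh1 ha hstar hgc hg0 hgpos hinf
  set R := max R₀ r + 1
  have hR₀ : R₀ < R := (le_max_left _ _).trans_lt (lt_add_one _)
  have hrR : r < R := (le_max_right _ _).trans_lt (lt_add_one _)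
  have hb : ∀ x y, IntervalIntegrable (fun s => max (a s) 0) volume x y := fun x y =>
    ⟨(ha x y).1.pos_part, (ha x y).2.pos_part⟩
  have hbper : Function.Periodic (fun s => max (a s) 0) T := fun t => by simp only [haper t]
  have hbpos : 0 < ∫ t in (0 : ℝ)..T, max (a t) 0 := by
    have h0 := hstar.1 0
    obtain ⟨κ, hκ, hκa⟩ := exists_le_integral_of_pos ha hstar (sub_pos.2 h0)
    have h1 := hκa 0 (σ 0) le_rfl (by linarith)
    rw [add_sub_cancel] at h1
    have h2 := hbper.intervalIntegral_add_eq 0 (σ 0)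
    rw [zero_add] at h2
    rw [h2]
    refine (hκ.trans_le h1).trans_le ((intervalIntegral.integral_mono h0.le (ha _ _) (hb _ _)
      fun t => le_max_left _ _).trans ?_)
    exact intervalIntegral.integral_mono_interval le_rfl h0.le (hstar.2.2.1 0).le
      (ae_of_all _ fun _ => le_max_right _ _) (hb _ _)
  set gt : ℝ → ℝ := fun x => g (max 0 (min x (R + 1)))
  have hgt : Continuous gt :=
    hgc.comp_continuous (by fun_prop) fun t => mem_Ici.2 (le_max_left _ _)
  obtain ⟨G, hG⟩ : ∃ G, ∀ x, |gt x| ≤ G := by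
    obtain ⟨G, hG⟩ := (isCompact_Icc (a := 0) (b := R + 1)).exists_bound_of_continuousOn
      (hgc.mono fun x hx => hx.1)
    exact ⟨G, fun x => hG _ ⟨le_max_left _ _, max_le (by linarith) (min_le_right _ _)⟩⟩
  have hG0 : 0 ≤ G := (abs_nonneg _).trans (hG 0)
  set A := ∫ t in (0 : ℝ)..T, ‖a t‖
  have hA : 0 ≤ A := intervalIntegral.integral_nonneg hT.le fun _ _ => norm_nonneg _
  set B := ∫ t in (0 : ℝ)..T, max (a t) 0
  set D := (G * A + 1) / B
  have hD : 0 < D := by positivity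
  have hDB : D * B = G * A + 1 := div_mul_cancel₀ _ hbpos.ne'
  have hagt : ∀ w : ℝ → ℝ, |∫ t in (0 : ℝ)..T, a t * gt (w t)| ≤ G * A := fun w =>
    abs_integral_mul_le_of_periodic ha haper hT.le (by simp) hG0 fun t _ => hG (w t)
  set β : ℝ → ℝ := fun x => max 0 (min 1 (r - x))
  set α : ℝ → ℝ := fun x => D * max 0 (min 1 (x - R))
  have hβ0 : ∀ x, r ≤ x → β x = 0 := fun x hx =>
    max_eq_left ((min_le_right _ _).trans (by linarith))
  have hβpos : ∀ x, x < r → 0 < β x := fun x hx =>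
    lt_max_of_lt_right (lt_min one_pos (by linarith))
  have hα0 : ∀ x, x ≤ R → α x = 0 := fun x hx => by
    simp only [α]
    rw [max_eq_left ((min_le_right _ _).trans (by linarith)), mul_zero]
  have hα1 : ∀ x, R + 1 ≤ x → α x = D := fun x hx => by
    simp only [α]
    rw [min_eq_left (by linarith), max_eq_right zero_le_one, mul_one]
  have hα_nonneg : ∀ x, 0 ≤ α x := fun x => mul_nonneg hD.le (le_max_left _ _)
  have hcut : ∀ x : ℝ, |max 0 (min 1 x)| ≤ 1 := fun x => by
    rw [abs_of_nonneg (le_max_left _ _)]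
    exact max_le zero_le_one (min_le_left _ _)
  obtain ⟨u, v, z, hcu, hcv, huper, hvper, hz, hu, hv⟩ :=
    exists_periodic_modified hT hhc hhper hh0 hh1 ha hb haper hbper hgt (α := α) (β := β)
      (by fun_prop) (by fun_prop) (B := max G (max D 1)) (fun x => (hG x).trans (le_max_left _ _))
      (fun x => by
        simp only [α]
        rw [abs_mul, abs_of_pos hD]
        exact (mul_le_of_le_one_right hD.le (hcut _)).trans
          ((le_max_left _ _).trans (le_max_right _ _)))
      (fun x => (hcut _).trans ((le_max_right _ _).trans (le_max_right _ _)))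
      (C₀ := R + 1) (y₀ := 0) (y₁ := g (R + 1))
      (fun x hx => by
        simp only [gt]
        rw [max_eq_left ((min_le_left _ _).trans (by linarith)), hg0])
      (fun x hx => by
        simp only [gt]
        rw [min_eq_right hx, max_eq_right (by linarith)])
      (fun x hx => by
        rw [hα0 x (by linarith)]
        have := mul_pos (hβpos x (by linarith)) hT
        linarith)
      (fun x hx => by
        have h1 := hagt fun _ => R + 1
        have h2 : gt (R + 1) = g (R + 1) := by
          simp only [gt]
          rw [min_self, max_eq_right (by linarith)]
        rw [h2, intervalIntegral.integral_mul_const] at h1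
        rw [hα1 x hx, hβ0 x (by linarith), hDB]
        linarith [(abs_le.1 h1).1])
  have hagi : ∀ x y, IntervalIntegrable (fun s => a s * gt (u s)) volume x y :=
    fun x y => (ha x y).mul_continuousOn (hgt.comp hcu).continuousOn
  have hagin : ∀ x y, IntervalIntegrable (fun s => -(a s * gt (u s))) volume x y :=
    fun x y => (hagi x y).neg
  have hint : ∀ x y, IntervalIntegrable
      (fun s => -(a s * gt (u s)) + β (u z) - α (u z) * max (a s) 0) volume x y :=
    fun x y => ((hagin x y).add intervalIntegrable_const).sub ((hb x y).const_mul _)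
  have hch : Continuous fun s => h s (v s) := hhc.comp (continuous_id.prodMk hcv)
  have hud : ∀ t, HasDerivAt u (h t (v t)) t := fun t => by
    have h1 := (intervalIntegral.integral_hasDerivAt_right (hch.intervalIntegrable 0 t)
      (hch.stronglyMeasurableAtFilter _ _) hch.continuousAt).const_add (u 0)
    exact h1.congr_of_eventuallyEq (Eventually.of_forall hu)
  have hvd : ∀ x y, v y - v x =
      ∫ s in x..y, (-(a s * gt (u s)) + β (u z) - α (u z) * max (a s) 0) := fun x y => by
    rw [← intervalIntegral.integral_interval_sub_left (hint 0 y) (hint 0 x), hv y, hv x]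
    ring
  have hmean : -(∫ s in (0 : ℝ)..T, a s * gt (u s)) + β (u z) * T - α (u z) * B = 0 := by
    have h1 := hvd 0 T
    have h2 := hvper 0
    rw [zero_add] at h2
    rw [h2, sub_self, intervalIntegral.integral_sub ((hagin _ _).add intervalIntegrable_const)
        ((hb _ _).const_mul _), intervalIntegral.integral_add (hagin _ _) intervalIntegrable_const,
      intervalIntegral.integral_neg, intervalIntegral.integral_const_mul,
      intervalIntegral.integral_const, smul_eq_mul] at h1
    linarith
  have hzR : u z < R + 1 := by
    by_contra! hzR
    have h1 := hagt u
    rw [hα1 _ hzR, hβ0 _ (by linarith), hDB] at hmean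
    linarith [(abs_le.1 h1).1]
  have hgu : ∀ t, gt (u t) = g (max 0 (u t)) := fun t => by
    simp only [gt]
    rw [min_eq_left ((hz t).trans hzR.le)]
  simp only [hgu] at hvd hmean
  have hz0 : 0 < u z := by
    by_contra! hz0
    have h1 : ∀ t, g (max 0 (u t)) = 0 := fun t => by
      rw [max_eq_left ((hz t).trans hz0), hg0]
    rw [hα0 _ (by linarith)] at hmean
    simp only [h1, mul_zero, intervalIntegral.integral_zero] at hmean
    have := mul_pos (hβpos (u z) (by linarith)) hT
    linarith
  have hrz : r ≤ u z := by
    by_contra! hlt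
    have h1 := hlower u v (β (u z)) z huper hvper hud (fun x y => by
      rw [hvd x y, hα0 _ (by linarith)]
      simp) hz hz0 (hβpos _ hlt)
    linarith
  simp only [hβ0 _ hrz, add_zero] at hvd
  have hu0 : ∀ t, 0 ≤ u t := nonneg_of_antitone_of_neg hT hh0 hh1 huper hud (fun x y hxy hneg => by
    rw [← sub_nonpos, hvd x y, ← neg_nonneg, ← intervalIntegral.integral_neg]
    refine intervalIntegral.integral_nonneg hxy fun t ht => ?_
    rw [max_eq_left (hneg t ht).le, hg0]
    have := mul_nonneg (hα_nonneg (u z)) (le_max_right (a t) 0)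
    linarith) hz0.le
  have hmax : ∀ t, max 0 (u t) = u t := fun t => max_eq_right (hu0 t)
  simp only [hmax] at hvd hgu
  have hzR₀ := hupper u v (α (u z)) z (hα_nonneg _) huper hud hvd hu0 hz
  simp only [hα0 _ (hzR₀.trans hR₀.le), zero_mul, sub_zero] at hvd
  refine ⟨u, v, ⟨hcu, hcv, huper, hvper, fun x y => hch.intervalIntegrable x y, fun x y => ?_, hu,
    fun t => ?_⟩, pos_of_nonneg hT hh0 hh1 ha haper hgc hg0 hgpos hzero huper hud hvd hu0 hz0⟩
  · simpa only [hgu] using hagin x y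
  · linarith [hvd 0 t]

theorem statement1
    (T : ℝ) (hT : 0 < T)
    (h : ℝ → ℝ → ℝ) (hhc : Continuous (Function.uncurry h))
    (hhper : ∀ t s : ℝ, h (t + T) s = h t s)
    (hh0 : ∀ t : ℝ, h t 0 = 0)
    (hh1 : ∀ t : ℝ, StrictMono (h t))
    (a : ℝ → ℝ) (haloc : LocallyIntegrable a volume)
    (haper : Function.Periodic a T)
    (haneg : (∫ t in (0:ℝ)..T, a t) < 0)
    (N : ℕ) (σ τ : Fin (N + 1) → ℝ) (hstar : SignChanging T a N σ τ)
    (g : ℝ → ℝ) (hgc : ContinuousOn g (Set.Ici 0))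
    (hg0 : g 0 = 0) (hgpos : ∀ s : ℝ, 0 < s → 0 < g s)
    (hreg : RegOscZero g)
    (hzero : ∀ K : ℝ, TendstoUniformly (fun s t => h t (K * g s) / s)
      (fun _ => 0) (nhdsWithin 0 (Set.Ioi 0)))
    (hinf : ∀ K : ℝ, K ≠ 0 → ∀ M : ℝ, ∀ᶠ s in Filter.atTop,
      ∀ t : ℝ, M ≤ Real.sign K * (h t (K * g s) / s)) :
    ∀ lam : ℝ, 0 < lam →
      ∃ u v : ℝ → ℝ,
        IsPeriodicSol T h (fun t x => -(lam * a t * g x)) u v ∧ ∀ t, 0 < u t := by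
  intro lam hlam
  have ha : ∀ x y, IntervalIntegrable a volume x y := fun x y =>
    (haloc.integrableOn_isCompact isCompact_uIcc).intervalIntegrable
  obtain ⟨h1, h2, h3, h4, h5⟩ := hstar
  refine exists_pos_periodicSol hT hhc hhper hh0 hh1 (a := fun t => lam * a t)
    (fun x y => (ha x y).const_mul lam) (fun t => by simp only [haper t]) ?_
    (N := N) (σ := σ) (τ := τ) ⟨h1, h2, h3, fun n => ?_, ?_⟩ hgc hg0 hgpos hreg hzero hinf
  · rw [intervalIntegral.integral_const_mul]
    exact mul_neg_of_pos_of_neg hlam haneg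
  · filter_upwards [h4 n] with t ht hmem
    exact mul_pos hlam (ht hmem)
  · filter_upwards [h5] with t ht hmem
    exact mul_nonpos_of_nonneg_of_nonpos hlam.le (ht hmem)
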